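/- arXiv:math/0606241 — 10 statements merged into one kernel-verified Lean document; each statement's English description precedes it below -/
import Mathlib

section
/- Let B be a counital coalgebra over a field k. Then B is the union of its finite-dimensional subcoalgebras: every element x ∈ B lies in a finite-dimensional subcoalgebra B_x ⊆ B, and more generally every finite-dimensional k-subspace of B is contained in a finite-dimensional subcoalgebra of B. -/
open scoped TensorProduct

namespace TensorProduct

variable {k M N : Type*} [Field k] [AddCommGroup M] [Module k M] [AddCommGroup N] [Module k N]

/-- Contraction of the left tensor factor with a functional. -/
noncomputable def leftSlice : Module.Dual k M →ₗ[k] M ⊗[k] N →ₗ[k] N :=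
  (LinearMap.compRight k (TensorProduct.lid k N).toLinearMap) ∘ₗ LinearMap.rTensorHom N

/-- Contraction of the right tensor factor with a functional. -/
noncomputable def rightSlice : Module.Dual k N →ₗ[k] M ⊗[k] N →ₗ[k] M :=
  (LinearMap.compRight k (TensorProduct.rid k M).toLinearMap) ∘ₗ LinearMap.lTensorHom M

@[simp]
lemma leftSlice_tmul (f : Module.Dual k M) (m : M) (n : N) :
    leftSlice f (m ⊗ₜ[k] n) = f m • n := by
  simp [leftSlice]

@[simp]
lemma rightSlice_tmul (f : Module.Dual k N) (m : M) (n : N) :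
    rightSlice f (m ⊗ₜ[k] n) = f n • m := by
  simp [rightSlice]

lemma leftSlice_comm (f : Module.Dual k N) (t : M ⊗[k] N) :
    leftSlice f (TensorProduct.comm k M N t) = rightSlice f t := by
  induction t with
  | zero => simp
  | tmul m n => simp
  | add s t hs ht => simp [hs, ht]

lemma leftSlice_map_right {N' : Type*} [AddCommGroup N'] [Module k N'] (g : N →ₗ[k] N')
    (f : Module.Dual k M) (t : M ⊗[k] N) :
    leftSlice f (g.lTensor M t) = g (leftSlice f t) := by
  induction t with
  | zero => simp
  | tmul m n => simp
  | add s t hs ht => simp [hs, ht]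

lemma eq_zero_of_leftSlice_eq_zero {t : M ⊗[k] N}
    (h : ∀ f : Module.Dual k M, leftSlice f t = 0) : t = 0 := by
  classical
  let b := Module.Basis.ofVectorSpace k M
  apply (TensorProduct.equivFinsuppOfBasisLeft (N := N) b).injective
  ext i
  rw [map_zero, Finsupp.zero_apply, ← h (b.coord i)]
  clear h
  induction t with
  | zero => simp
  | tmul m n => simp
  | add s t hs ht => simp [hs, ht]

lemma lTensor_eq_self_of_leftSlice_mem {C : Submodule k N} {P : N →ₗ[k] N}
    (hP : ∀ n ∈ C, P n = n) {t : M ⊗[k] N}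
    (h : ∀ f : Module.Dual k M, leftSlice f t ∈ C) : P.lTensor M t = t := by
  rw [← sub_eq_zero]
  apply eq_zero_of_leftSlice_eq_zero
  intro f
  rw [map_sub, leftSlice_map_right, hP _ (h f), sub_self]

lemma rTensor_eq_self_of_rightSlice_mem {C : Submodule k M} {P : M →ₗ[k] M}
    (hP : ∀ m ∈ C, P m = m) {t : M ⊗[k] N}
    (h : ∀ f : Module.Dual k N, rightSlice f t ∈ C) : P.rTensor N t = t := by
  apply (TensorProduct.comm k M N).injective
  refine (TensorProduct.map_comm .id P t).symm.trans ?_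
  exact lTensor_eq_self_of_leftSlice_mem hP fun f ↦ by simpa only [leftSlice_comm] using h f

/-- A tensor all of whose left and right slices lie in `C` comes from `C ⊗ C`. -/
lemma mem_range_map_subtype_of_slices_mem {C : Submodule k M} {t : M ⊗[k] M}
    (hl : ∀ f : Module.Dual k M, leftSlice f t ∈ C)
    (hr : ∀ f : Module.Dual k M, rightSlice f t ∈ C) :
    t ∈ LinearMap.range (TensorProduct.map C.subtype C.subtype) := by
  obtain ⟨p, hp⟩ := C.subtype.exists_leftInverse_of_injective C.ker_subtype
  have hP : ∀ m ∈ C, (C.subtype ∘ₗ p) m = m := fun m hm ↦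
    congrArg Subtype.val (LinearMap.congr_fun hp ⟨m, hm⟩)
  refine ⟨TensorProduct.map p p t, ?_⟩
  rw [← LinearMap.comp_apply, ← TensorProduct.map_comp, ← LinearMap.rTensor_comp_lTensor,
    LinearMap.comp_apply, lTensor_eq_self_of_leftSlice_mem hP hl,
    rTensor_eq_self_of_rightSlice_mem hP hr]

lemma fg_range_flip_leftSlice (t : M ⊗[k] N) :
    (LinearMap.range ((leftSlice (k := k) (M := M) (N := N)).flip t)).FG := by
  suffices h : ∃ S : Submodule k N, S.FG ∧ ∀ f : Module.Dual k M, leftSlice f t ∈ S by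
    obtain ⟨S, hS, h⟩ := h
    refine hS.of_le ?_
    rintro _ ⟨f, rfl⟩
    exact h f
  induction t with
  | zero => exact ⟨⊥, Submodule.fg_bot, by simp⟩
  | tmul m n =>
    exact ⟨k ∙ n, Submodule.fg_span_singleton n, fun f ↦ by
      simpa using Submodule.smul_mem _ _ (Submodule.mem_span_singleton_self n)⟩
  | add s t hs ht =>
    obtain ⟨S, hS, hs⟩ := hs
    obtain ⟨T, hT, ht⟩ := ht
    exact ⟨S ⊔ T, hS.sup hT, fun f ↦ by
      simpa using Submodule.add_mem_sup (hs f) (ht f)⟩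

lemma fg_range_flip_rightSlice (t : M ⊗[k] N) :
    (LinearMap.range ((rightSlice (k := k) (M := M) (N := N)).flip t)).FG := by
  convert fg_range_flip_leftSlice (TensorProduct.comm k M N t) using 2
  ext f
  exact (leftSlice_comm f t).symm

end TensorProduct

lemma Submodule.FG.map₂_top {k M N P : Type*} [Field k] [AddCommGroup M] [Module k M]
    [AddCommGroup N] [Module k N] [AddCommGroup P] [Module k P] (b : M →ₗ[k] N →ₗ[k] P)
    (hb : ∀ n, (LinearMap.range (b.flip n)).FG) {V : Submodule k N} (hV : V.FG) :
    (Submodule.map₂ b ⊤ V).FG := by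
  induction V, hV using Submodule.fg_induction with
  | singleton n =>
    rw [Submodule.map₂_span_singleton_eq_map_flip, Submodule.map_top]
    exact hb n
  | sup V W _ _ hV hW =>
    rw [Submodule.map₂_sup_right]
    exact hV.sup hW

namespace Coalgebra

open _root_.TensorProduct

variable {k B : Type*} [Field k] [AddCommGroup B] [Module k B] [Coalgebra k B]

variable (k B) in
/-- The action `x ↦ ∑ f(x₁) x₂` of a functional on a coalgebra. -/
noncomputable def leftHit : Module.Dual k B →ₗ[k] B →ₗ[k] B :=
  (LinearMap.lcomp k B comul) ∘ₗ leftSlice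

variable (k B) in
/-- The action `x ↦ ∑ f(x₂) x₁` of a functional on a coalgebra. -/
noncomputable def rightHit : Module.Dual k B →ₗ[k] B →ₗ[k] B :=
  (LinearMap.lcomp k B comul) ∘ₗ rightSlice

lemma leftHit_apply (f : Module.Dual k B) (x : B) :
    leftHit k B f x = leftSlice f (comul (R := k) x) := rfl

lemma rightHit_apply (f : Module.Dual k B) (x : B) :
    rightHit k B f x = rightSlice f (comul (R := k) x) := rfl

lemma leftHit_counit (x : B) : leftHit k B counit x = x := by
  simp [leftHit, leftSlice]

lemma rightHit_counit (x : B) : rightHit k B counit x = x := by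
  simp [rightHit, rightSlice]

lemma comul_leftHit (f : Module.Dual k B) (x : B) :
    comul (R := k) (leftHit k B f x) =
      leftSlice f (comul.lTensor B (comul (R := k) x)) := by
  rw [leftSlice_map_right, leftHit_apply]

lemma leftHit_leftHit (f g : Module.Dual k B) (x : B) :
    leftHit k B f (leftHit k B g x) = leftHit k B (f ∘ₗ leftHit k B g) x := by
  have key : (leftSlice f ∘ₗ leftSlice g) ∘ₗ (_root_.TensorProduct.assoc k B B B).toLinearMap =
      leftSlice (k := k) (N := B) (f ∘ₗ leftSlice g) := by
    ext a b c
    simp [mul_smul]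
  have key' (t : B ⊗[k] B) : leftSlice (k := k) (N := B) (f ∘ₗ leftSlice g)
      (comul.rTensor B t) = leftSlice (f ∘ₗ leftHit k B g) t := by
    induction t with
    | zero => simp
    | tmul m n => simp [leftHit_apply]
    | add s t hs ht => simp [hs, ht]
  rw [leftHit_apply, comul_leftHit, ← coassoc_apply, leftHit_apply, ← key', ← key]
  rfl

lemma rightHit_leftHit (f g : Module.Dual k B) (x : B) :
    rightHit k B f (leftHit k B g x) = leftHit k B g (rightHit k B f x) := by
  have key : (rightSlice f ∘ₗ leftSlice g) ∘ₗ (_root_.TensorProduct.assoc k B B B).toLinearMap =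
      leftSlice g ∘ₗ rightSlice (k := k) (M := B ⊗[k] B) f := by
    ext a b c
    simp [smul_comm (g a) (f c)]
  have key' (t : B ⊗[k] B) : rightSlice (k := k) (M := B ⊗[k] B) f (comul.rTensor B t) =
      comul (R := k) (rightSlice f t) := by
    induction t with
    | zero => simp
    | tmul m n => simp
    | add s t hs ht => simp [hs, ht]
  rw [rightHit_apply, comul_leftHit, ← coassoc_apply, leftHit_apply, rightHit_apply, ← key']
  exact LinearMap.congr_fun key _

lemma rightHit_rightHit (f g : Module.Dual k B) (x : B) :
    rightHit k B f (rightHit k B g x) = rightHit k B (f ∘ₗ rightHit k B g) x := by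
  have key : rightSlice f ∘ₗ rightSlice (k := k) (M := B ⊗[k] B) g =
      rightSlice (k := k) (M := B) (f ∘ₗ rightSlice g) ∘ₗ
        (_root_.TensorProduct.assoc k B B B).toLinearMap := by
    ext a b c
    simp [mul_smul]
  have key' (t : B ⊗[k] B) : rightSlice (k := k) (M := B ⊗[k] B) g (comul.rTensor B t) =
      comul (R := k) (rightSlice g t) := by
    induction t with
    | zero => simp
    | tmul m n => simp
    | add s t hs ht => simp [hs, ht]
  have key'' (t : B ⊗[k] B) : rightSlice (k := k) (M := B) (f ∘ₗ rightSlice g)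
      (comul.lTensor B t) = rightSlice (f ∘ₗ rightHit k B g) t := by
    induction t with
    | zero => simp
    | tmul m n => simp [rightHit_apply]
    | add s t hs ht => simp [hs, ht]
  rw [rightHit_apply, rightHit_apply, ← key', rightHit_apply, ← key'', ← coassoc_apply]
  exact LinearMap.congr_fun key _

/-- Every finite-dimensional subspace of a coalgebra over a field is contained in a
finite-dimensional subcoalgebra. -/
theorem exists_finiteDimensional_subcoalgebra_ge (V : Submodule k B) [FiniteDimensional k V] :
    ∃ C : Submodule k B, V ≤ C ∧ FiniteDimensional k C ∧
      ∀ y ∈ C, comul (R := k) y ∈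
        LinearMap.range (_root_.TensorProduct.map C.subtype C.subtype) := by
  let D := Submodule.map₂ (rightHit k B) ⊤ V
  let C := Submodule.map₂ (leftHit k B) ⊤ D
  have hD : D.FG := Submodule.FG.map₂_top _ (fun x ↦ fg_range_flip_rightSlice (comul x))
    (Submodule.fg_iff_finiteDimensional V |>.mpr inferInstance)
  have hC : C.FG := Submodule.FG.map₂_top _ (fun x ↦ fg_range_flip_leftSlice (comul x)) hD
  have hDr (f : Module.Dual k B) : D ≤ D.comap (rightHit k B f) := by
    refine Submodule.map₂_le.mpr fun g _ x hx ↦ ?_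
    rw [Submodule.mem_comap, rightHit_rightHit]
    exact Submodule.apply_mem_map₂ _ trivial hx
  have hCr (f : Module.Dual k B) : C ≤ C.comap (rightHit k B f) := by
    refine Submodule.map₂_le.mpr fun g _ x hx ↦ ?_
    rw [Submodule.mem_comap, rightHit_leftHit]
    exact Submodule.apply_mem_map₂ _ trivial (hDr f hx)
  have hCl (f : Module.Dual k B) : C ≤ C.comap (leftHit k B f) := by
    refine Submodule.map₂_le.mpr fun g _ x hx ↦ ?_
    rw [Submodule.mem_comap, leftHit_leftHit]
    exact Submodule.apply_mem_map₂ _ trivial hx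
  refine ⟨C, fun x hx ↦ ?_, Submodule.fg_iff_finiteDimensional C |>.mp hC, fun y hy ↦
    mem_range_map_subtype_of_slices_mem (fun f ↦ hCl f hy) fun f ↦ hCr f hy⟩
  rw [← leftHit_counit (k := k) x, ← rightHit_counit (k := k) x]
  exact Submodule.apply_mem_map₂ _ trivial (Submodule.apply_mem_map₂ _ trivial hx)

end Coalgebra

/-- **Every counital coalgebra over a field is the union of its finite-dimensional
subcoalgebras.** Every element `x` of `B` lies in a finite-dimensional subcoalgebra
`B_x ⊆ B`, and more generally every finite-dimensional subspace `V ⊆ B` is contained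
in a finite-dimensional subcoalgebra of `B`.  Here a subcoalgebra is a `k`-subspace
`C` such that `comul C` is contained in the image of `C ⊗ C` in `B ⊗ B`. -/
theorem coalgebra_union_of_finiteDimensional_subcoalgebras
    (k B : Type) [Field k] [AddCommGroup B] [Module k B] [Coalgebra k B] :
    (∀ x : B, ∃ C : Submodule k B, x ∈ C ∧ FiniteDimensional k C ∧
      ∀ y ∈ C, Coalgebra.comul (R := k) y ∈
        LinearMap.range (TensorProduct.map C.subtype C.subtype)) ∧
    (∀ V : Submodule k B, FiniteDimensional k V →
      ∃ C : Submodule k B, V ≤ C ∧ FiniteDimensional k C ∧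
      ∀ y ∈ C, Coalgebra.comul (R := k) y ∈
        LinearMap.range (TensorProduct.map C.subtype C.subtype)) := by
  refine ⟨fun x ↦ ?_, fun V _ ↦ Coalgebra.exists_finiteDimensional_subcoalgebra_ge V⟩
  obtain ⟨C, hx, hC⟩ := Coalgebra.exists_finiteDimensional_subcoalgebra_ge (k ∙ x)
  exact ⟨C, hx (Submodule.mem_span_singleton_self x), hC⟩
end

section
/- Let B be a counital coalgebra over a field k, let s be a finite index set, and let x ∈ B and families (a_i)_{i∈s}, (b_i)_{i∈s} of elements of B be such that Δ(x) = Σ_{i∈s} a_i ⊗ b_i and each of the families (a_i)_{i∈s} and (b_i)_{i∈s} is linearly independent over k. Then there exist elements c_{ij} ∈ B (i, j ∈ s) such that for every i ∈ s one has Δ(a_i) = Σ_{j∈s} a_j ⊗ c_{ij} and Δ(b_i) = Σ_{j∈s} c_{ji} ⊗ b_j. -/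
open scoped TensorProduct

/-- A linearly independent family over a field admits a dual family of linear functionals. -/
theorem LinearIndependent.exists_dual_family {K V ι : Type*} [Field K] [AddCommGroup V]
    [Module K V] [DecidableEq ι] {v : ι → V} (hv : LinearIndependent K v) :
    ∃ f : ι → V →ₗ[K] K, ∀ i j, f i (v j) = if j = i then 1 else 0 := by
  obtain ⟨g, hg⟩ := LinearMap.exists_leftInverse_of_injective
    (Finsupp.linearCombination K v) (LinearMap.ker_eq_bot.mpr hv)
  refine ⟨fun i => Finsupp.lapply i ∘ₗ g, fun i j => ?_⟩
  have h := LinearMap.congr_fun hg (Finsupp.single j 1)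
  simp only [LinearMap.comp_apply, Finsupp.linearCombination_single, one_smul,
    LinearMap.id_apply] at h
  simp [h, Finsupp.single_apply]

/-- Given `Δ(x) = ∑ i, a i ⊗ b i` in a counital coalgebra `B` over a field `k`, with both
families `(a i)` and `(b i)` linearly independent, there exist elements `c i j ∈ B` such
that `Δ(a i) = ∑ j, a j ⊗ c i j` and `Δ(b i) = ∑ j, c j i ⊗ b j` for every `i`. -/
theorem exists_structure_coefficients
    (k B : Type) [Field k] [AddCommGroup B] [Module k B] [Coalgebra k B]
    (ι : Type) [Fintype ι] (x : B) (a b : ι → B)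
    (hx : Coalgebra.comul (R := k) x = ∑ i : ι, a i ⊗ₜ[k] b i)
    (ha : LinearIndependent k a) (hb : LinearIndependent k b) :
    ∃ c : ι → ι → B,
      (∀ i : ι, Coalgebra.comul (R := k) (a i) = ∑ j : ι, a j ⊗ₜ[k] c i j) ∧
      (∀ i : ι, Coalgebra.comul (R := k) (b i) = ∑ j : ι, c j i ⊗ₜ[k] b j) := by
  classical
  obtain ⟨f, hf⟩ := ha.exists_dual_family
  obtain ⟨g, hg⟩ := hb.exists_dual_family
  have coassoc : ∑ i, TensorProduct.assoc k B B B (Coalgebra.comul (R := k) (a i) ⊗ₜ[k] b i) =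
      ∑ i, a i ⊗ₜ[k] Coalgebra.comul (R := k) (b i) := by
    simpa [hx] using Coalgebra.coassoc_apply (R := k) x
  let c : ι → ι → B := fun i j =>
    TensorProduct.rid k B ((g i).lTensor B (Coalgebra.comul (R := k) (b j)))
  have comul_a : ∀ i, Coalgebra.comul (R := k) (a i) = ∑ j, a j ⊗ₜ[k] c i j := by
    intro i
    have slice : ∀ (t : B ⊗[k] B) (y : B),
        ((TensorProduct.rid k B).toLinearMap ∘ₗ (g i).lTensor B).lTensor B
          (TensorProduct.assoc k B B B (t ⊗ₜ[k] y)) = g i y • t := by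
      intro t y
      induction t with
      | zero => simp
      | tmul u v => simp
      | add u v hu hv => simp only [TensorProduct.add_tmul, map_add, hu, hv, smul_add]
    have h := congrArg
      (((TensorProduct.rid k B).toLinearMap ∘ₗ (g i).lTensor B).lTensor B) coassoc
    simp only [map_sum, slice, hg, ite_smul, one_smul, zero_smul, Finset.sum_ite_eq',
      Finset.mem_univ, if_true] at h
    simpa [c] using h
  refine ⟨c, comul_a, fun i => ?_⟩
  have h := congrArg
    ((TensorProduct.lid k (B ⊗[k] B)).toLinearMap ∘ₗ (f i).rTensor (B ⊗[k] B)) coassoc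
  simpa [comul_a, TensorProduct.sum_tmul, hf, ite_smul] using h.symm
end

section
/- Let B be a counital coalgebra over a field k, let s be a finite index set, and let x ∈ B and families (a_i)_{i∈s}, (b_i)_{i∈s} of elements of B be such that Δ(x) = Σ_{i∈s} a_i ⊗ b_i and each of the families (a_i)_{i∈s} and (b_i)_{i∈s} is linearly independent over k. Suppose moreover that elements c_{ij} ∈ B (i, j ∈ s) satisfy Δ(a_i) = Σ_{j∈s} a_j ⊗ c_{ij} and Δ(b_i) = Σ_{j∈s} c_{ji} ⊗ b_j for all i ∈ s. Then the k-linear span B_x of the set {x} ∪ {a_i : i ∈ s} ∪ {b_i : i ∈ s} ∪ {c_{ij} : i, j ∈ s} is a finite-dimensional subcoalgebra of B containing x; in particular Δ(c_{ij}) lies in the image of B_x ⊗ B_x in B ⊗ B for all i, j ∈ s. -/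
open scoped TensorProduct

/-- Coefficients of a linearly independent family in the left tensor factor are unique. -/
theorem LinearIndependent.eq_of_sum_tmul_eq {k M N ι : Type*} [Field k] [AddCommGroup M]
    [Module k M] [AddCommGroup N] [Module k N] [Fintype ι] {a : ι → M}
    (ha : LinearIndependent k a) {u v : ι → N}
    (h : ∑ j, a j ⊗ₜ[k] u j = ∑ j, a j ⊗ₜ[k] v j) : u = v := by
  classical
  obtain ⟨f, hf⟩ := LinearMap.exists_leftInverse_of_injective
    (Finsupp.linearCombination k a) (LinearMap.ker_eq_bot.2 ha)
  have hfa (j : ι) : f (a j) = Finsupp.single j 1 := by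
    simpa using LinearMap.congr_fun hf (Finsupp.single j 1)
  funext l
  have key (w : ι → N) : TensorProduct.lid k N
      ((Finsupp.lapply l ∘ₗ f).rTensor N (∑ j, a j ⊗ₜ[k] w j)) = w l := by
    simp [hfa, Finsupp.single_apply]
  rw [← key u, h, key v]

/-- If `Δ(a i) = ∑ j, a j ⊗ c i j` for a linearly independent family `a`, then the
coefficients `c i j` comultiply like the entries of a matrix. -/
theorem LinearIndependent.comul_coeff {k B ι : Type*} [Field k] [AddCommGroup B] [Module k B]
    [Coalgebra k B] [Fintype ι] {a : ι → B} {c : ι → ι → B} (ha : LinearIndependent k a)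
    (hca : ∀ i, Coalgebra.comul (R := k) (a i) = ∑ j, a j ⊗ₜ[k] c i j) (i l : ι) :
    Coalgebra.comul (R := k) (c i l) = ∑ j, c j l ⊗ₜ[k] c i j := by
  refine congrFun (ha.eq_of_sum_tmul_eq (u := fun l => Coalgebra.comul (R := k) (c i l))
    (v := fun l => ∑ j, c j l ⊗ₜ[k] c i j) ?_) l
  have h := Coalgebra.coassoc_apply (R := k) (a i)
  simp only [hca, map_sum, LinearMap.rTensor_tmul, LinearMap.lTensor_tmul,
    TensorProduct.sum_tmul, TensorProduct.assoc_tmul] at h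
  rw [← h, Finset.sum_comm]
  simp only [TensorProduct.tmul_sum]

/-- Given `Δ(x) = ∑ i, a i ⊗ b i` in a counital coalgebra `B` over a field `k`, with both
families `(a i)` and `(b i)` linearly independent, and elements `c i j` satisfying
`Δ(a i) = ∑ j, a j ⊗ c i j` and `Δ(b i) = ∑ j, c j i ⊗ b j`, the span `B_x` of
`{x} ∪ {a i} ∪ {b i} ∪ {c i j}` is a finite-dimensional subcoalgebra of `B` containing
`x`; in particular `Δ(c i j)` lies in the image of `B_x ⊗ B_x` in `B ⊗ B`. -/
theorem span_is_finiteDimensional_subcoalgebra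
    (k B : Type) [Field k] [AddCommGroup B] [Module k B] [Coalgebra k B]
    (ι : Type) [Fintype ι] (x : B) (a b : ι → B) (c : ι → ι → B)
    (hx : Coalgebra.comul (R := k) x = ∑ i : ι, a i ⊗ₜ[k] b i)
    (ha : LinearIndependent k a) (hb : LinearIndependent k b)
    (hca : ∀ i : ι, Coalgebra.comul (R := k) (a i) = ∑ j : ι, a j ⊗ₜ[k] c i j)
    (hcb : ∀ i : ι, Coalgebra.comul (R := k) (b i) = ∑ j : ι, c j i ⊗ₜ[k] b j)
    (Bx : Submodule k B)
    (hBx : Bx = Submodule.span k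
      ({x} ∪ Set.range a ∪ Set.range b ∪ Set.range (fun p : ι × ι => c p.1 p.2))) :
    x ∈ Bx ∧ FiniteDimensional k Bx ∧
      (∀ y ∈ Bx, Coalgebra.comul (R := k) y ∈
        LinearMap.range (TensorProduct.map Bx.subtype Bx.subtype)) ∧
      (∀ i j : ι, Coalgebra.comul (R := k) (c i j) ∈
        LinearMap.range (TensorProduct.map Bx.subtype Bx.subtype)) := by
  have sum_mem (u v : ι → B) (hu : ∀ i, u i ∈ Bx) (hv : ∀ i, v i ∈ Bx) :
      ∑ i, u i ⊗ₜ[k] v i ∈ LinearMap.range (TensorProduct.map Bx.subtype Bx.subtype) :=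
    Submodule.sum_mem _ fun i _ => ⟨⟨u i, hu i⟩ ⊗ₜ[k] ⟨v i, hv i⟩, rfl⟩
  have hxm : x ∈ Bx := hBx ▸ Submodule.subset_span (by simp)
  have ham (i : ι) : a i ∈ Bx := hBx ▸ Submodule.subset_span (by simp)
  have hbm (i : ι) : b i ∈ Bx := hBx ▸ Submodule.subset_span (by simp)
  have hcm (i j : ι) : c i j ∈ Bx := hBx ▸ Submodule.subset_span (Or.inr ⟨(i, j), rfl⟩)
  have hc (i j : ι) : Coalgebra.comul (R := k) (c i j) ∈
      LinearMap.range (TensorProduct.map Bx.subtype Bx.subtype) := by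
    rw [ha.comul_coeff hca]
    exact sum_mem _ _ (fun l => hcm l j) (hcm i)
  refine ⟨hxm, ?_, ?_, hc⟩
  · rw [hBx]
    exact FiniteDimensional.span_of_finite k ((((Set.finite_singleton x).union
      (Set.finite_range a)).union (Set.finite_range b)).union (Set.finite_range _))
  · suffices h : Bx ≤ (LinearMap.range (TensorProduct.map Bx.subtype Bx.subtype)).comap
        (Coalgebra.comul (R := k)) from h
    conv_lhs => rw [hBx]
    rw [Submodule.span_le]
    rintro _ (((rfl | ⟨i, rfl⟩) | ⟨i, rfl⟩) | ⟨⟨i, j⟩, rfl⟩)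
    · rw [SetLike.mem_coe, Submodule.mem_comap, hx]
      exact sum_mem _ _ ham hbm
    · rw [SetLike.mem_coe, Submodule.mem_comap, hca]
      exact sum_mem _ _ ham (hcm i)
    · rw [SetLike.mem_coe, Submodule.mem_comap, hcb]
      exact sum_mem _ _ (fun j => hcm j i) hbm
    · exact hc i j
end

section
/- Let k be a field, (I, ≤) a directed partially ordered set, and (A_i, f_{ij}) an inverse system of finite-dimensional unital associative k-algebras indexed by I (so f_{ij} : A_j → A_i is a unital algebra homomorphism for i ≤ j, f_{ii} = id, and f_{ij} ∘ f_{jk} = f_{ik} for i ≤ j ≤ k). For each i ∈ I set Ā_i = ⋂_{j ≥ i} f_{ij}(A_j), a unital subalgebra of A_i. Then: (a) for all i ≤ j the map f_{ij} restricts to a surjective algebra homomorphism Ā_j → Ā_i; and (b) for every finite-dimensional unital k-algebra B, the restriction maps Hom_{Alg}(A_i, B) → Hom_{Alg}(Ā_i, B) are compatible with the transition maps (precomposition with f_{ij}) and induce a bijection colim_{i∈I} Hom_{Alg}(A_i, B) ≅ colim_{i∈I} Hom_{Alg}(Ā_i, B) of the filtered colimits of sets. -/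
section InverseSystem

variable {k : Type*} [CommSemiring k] {I : Type*} [Preorder I] [IsDirected I (· ≤ ·)]
  {A : I → Type*} [∀ i, Semiring (A i)] [∀ i, Algebra k (A i)]

/-- The relation identifying two homomorphisms out of members of an inverse system of algebras
when they agree after pulling back to a common index is an equivalence relation. -/
theorem equivalence_exists_comp_eq_comp (B : Type*) [Semiring B] [Algebra k B]
    (f : ∀ i j : I, i ≤ j → (A j →ₐ[k] A i))
    (hcomp : ∀ (i j l : I) (hij : i ≤ j) (hjl : j ≤ l),
      (f i j hij).comp (f j l hjl) = f i l (hij.trans hjl)) :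
    Equivalence (fun p q : Σ i : I, (A i →ₐ[k] B) =>
      ∃ (l : I) (hp : p.1 ≤ l) (hq : q.1 ≤ l),
        p.2.comp (f p.1 l hp) = q.2.comp (f q.1 l hq)) where
  refl p := ⟨p.1, le_rfl, le_rfl, rfl⟩
  symm := fun ⟨l, hp, hq, h⟩ => ⟨l, hq, hp, h.symm⟩
  trans := by
    rintro p q r ⟨l, hp, hq, h⟩ ⟨m, hq', hr, h'⟩
    obtain ⟨n, hln, hmn⟩ := exists_ge_ge l m
    refine ⟨n, hp.trans hln, hr.trans hmn, ?_⟩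
    rw [← hcomp _ _ _ hp hln, ← AlgHom.comp_assoc, h, AlgHom.comp_assoc, hcomp,
      ← hcomp _ _ _ hr hmn, ← AlgHom.comp_assoc, ← h', AlgHom.comp_assoc, hcomp]

end InverseSystem

/-- In an inverse system of finite-dimensional algebras the images in a fixed member stabilize. -/
theorem exists_range_eq_iInf_range {k : Type*} [Field k] {I : Type*} [Preorder I]
    [IsDirected I (· ≤ ·)] {A : I → Type*} [∀ i, Ring (A i)] [∀ i, Algebra k (A i)]
    (f : ∀ i j : I, i ≤ j → (A j →ₐ[k] A i))
    (hcomp : ∀ (i j l : I) (hij : i ≤ j) (hjl : j ≤ l),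
      (f i j hij).comp (f j l hjl) = f i l (hij.trans hjl))
    (i : I) [FiniteDimensional k (A i)] :
    ∃ (j : I) (h : i ≤ j), (f i j h).range = ⨅ (j : I) (h : i ≤ j), (f i j h).range := by
  have anti (j l : I) (hij : i ≤ j) (hjl : j ≤ l) :
      (f i l (hij.trans hjl)).range ≤ (f i j hij).range := by
    rw [← hcomp i j l hij hjl]
    exact AlgHom.range_comp_le_range _ _
  obtain ⟨⟨j, hij⟩, -, hmin⟩ := WellFounded.has_min
    (InvImage.wf (fun j : {j // i ≤ j} => Subalgebra.toSubmodule (f i j j.2).range)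
      (wellFounded_lt (α := Submodule k (A i)))) Set.univ ⟨⟨i, le_rfl⟩, trivial⟩
  refine ⟨j, hij, le_antisymm (le_iInf₂ fun m him => ?_) (iInf₂_le j hij)⟩
  obtain ⟨l, hjl, hml⟩ := exists_ge_ge j m
  have hle := anti j l hij hjl
  have hnot : ¬ (f i l (hij.trans hjl)).range < (f i j hij).range :=
    fun hlt => hmin ⟨l, hij.trans hjl⟩ trivial (Subalgebra.toSubmodule.lt_iff_lt.mpr hlt)
  exact (eq_of_le_of_not_lt hle hnot).ge.trans (anti m l him hml)


/-- Let `(A i, f i j)` be an inverse system of finite-dimensional unital associative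
algebras over a field `k`, indexed by a directed poset `I`, and for each `i` let
`Abar i = ⋂_{j ≥ i} range (f i j)`, a subalgebra of `A i`.  Then (a) for `i ≤ j` the
map `f i j` carries `Abar j` onto `Abar i` (so it restricts to a surjective algebra
homomorphism `g i j : Abar j →ₐ Abar i` agreeing with `f i j`); and (b) for any
finite-dimensional unital `k`-algebra `B`, the restriction maps
`Hom(A i, B) → Hom(Abar i, B)` are compatible with the transition maps and induce a
bijection `colim_i Hom(A i, B) ≅ colim_i Hom(Abar i, B)` of filtered colimits of sets
(here realized as quotients of the disjoint unions by the usual colimit relation). -/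
theorem restriction_induces_bijection_of_colimits
    (k : Type) [Field k] (I : Type) [PartialOrder I] [IsDirected I (· ≤ ·)]
    (A : I → Type) [∀ i, Ring (A i)] [∀ i, Algebra k (A i)]
    [∀ i, FiniteDimensional k (A i)]
    (B : Type) [Ring B] [Algebra k B] [FiniteDimensional k B]
    (f : ∀ i j : I, i ≤ j → (A j →ₐ[k] A i))
    (hid : ∀ i : I, f i i le_rfl = AlgHom.id k (A i))
    (hcomp : ∀ (i j l : I) (hij : i ≤ j) (hjl : j ≤ l),
      (f i j hij).comp (f j l hjl) = f i l (hij.trans hjl))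
    (Abar : ∀ i : I, Subalgebra k (A i))
    (hAbar : ∀ i : I, Abar i = ⨅ (j : I) (h : i ≤ j), (f i j h).range) :
    (∀ (i j : I) (h : i ≤ j), (Abar j).map (f i j h) = Abar i) ∧
    ∃ g : ∀ i j : I, i ≤ j → (↥(Abar j) →ₐ[k] ↥(Abar i)),
      (∀ (i j : I) (h : i ≤ j) (x : ↥(Abar j)), (g i j h x : A i) = f i j h (x : A j)) ∧
      (∀ (i j : I) (h : i ≤ j), Function.Surjective (g i j h)) ∧
      ∃ T : Quot (fun p q : Σ i : I, (A i →ₐ[k] B) =>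
              ∃ (l : I) (hp : p.1 ≤ l) (hq : q.1 ≤ l),
                p.2.comp (f p.1 l hp) = q.2.comp (f q.1 l hq)) →
            Quot (fun p q : Σ i : I, (↥(Abar i) →ₐ[k] B) =>
              ∃ (l : I) (hp : p.1 ≤ l) (hq : q.1 ≤ l),
                p.2.comp (g p.1 l hp) = q.2.comp (g q.1 l hq)),
        (∀ (i : I) (φ : A i →ₐ[k] B),
          T (Quot.mk _ ⟨i, φ⟩) = Quot.mk _ ⟨i, φ.comp (Abar i).val⟩) ∧
        Function.Bijective T := by
  have hcomp' (i j l : I) (hij : i ≤ j) (hjl : j ≤ l) (x : A l) :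
      f i j hij (f j l hjl x) = f i l (hij.trans hjl) x :=
    DFunLike.congr_fun (hcomp i j l hij hjl) x
  have hstab (i : I) : ∃ (j : I) (h : i ≤ j), (f i j h).range = Abar i := by
    rw [hAbar]
    exact exists_range_eq_iInf_range f hcomp i
  have hmap (i j : I) (h : i ≤ j) : (Abar j).map (f i j h) = Abar i := by
    apply le_antisymm
    · rintro _ ⟨x, hx, rfl⟩
      rw [hAbar]
      simp only [Algebra.mem_iInf]
      intro m him
      obtain ⟨l, hjl, hml⟩ := exists_ge_ge j m
      have hx' : x ∈ (f j l hjl).range :=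
        (hAbar j ▸ iInf₂_le l hjl : Abar j ≤ (f j l hjl).range) hx
      obtain ⟨y, rfl⟩ := hx'
      exact ⟨f m l hml y, (hcomp' i m l him hml y).trans (hcomp' i j l h hjl y).symm⟩
    · obtain ⟨l, hjl, hl⟩ := hstab j
      intro x hx
      have hx' : x ∈ (f i l (h.trans hjl)).range :=
        (hAbar i ▸ iInf₂_le l (h.trans hjl) : Abar i ≤ (f i l (h.trans hjl)).range) hx
      obtain ⟨y, rfl⟩ := hx'
      exact ⟨f j l hjl y, hl ▸ ⟨y, rfl⟩, hcomp' i j l h hjl y⟩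
  have hmem (i j : I) (h : i ≤ j) (x : Abar j) : f i j h x ∈ Abar i :=
    hmap i j h ▸ ⟨x, x.2, rfl⟩
  let g (i j : I) (h : i ≤ j) : ↥(Abar j) →ₐ[k] ↥(Abar i) :=
    ((f i j h).comp (Abar j).val).codRestrict (Abar i) (hmem i j h)
  have hgcomp (i j l : I) (hij : i ≤ j) (hjl : j ≤ l) :
      (g i j hij).comp (g j l hjl) = g i l (hij.trans hjl) :=
    AlgHom.ext fun x => Subtype.ext (hcomp' i j l hij hjl x)
  refine ⟨hmap, g, fun _ _ _ _ => rfl, fun i j h => ?_, ?_⟩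
  · rintro ⟨x, hx⟩
    rw [← hmap i j h] at hx
    obtain ⟨y, hy, rfl⟩ := hx
    exact ⟨⟨y, hy⟩, rfl⟩
  refine ⟨Quot.map (fun p => ⟨p.1, p.2.comp (Abar p.1).val⟩) ?_, fun _ _ => rfl, ?_, ?_⟩
  · rintro p q ⟨l, hp, hq, h⟩
    exact ⟨l, hp, hq, AlgHom.ext fun x => DFunLike.congr_fun h (x : A l)⟩
  · rintro ⟨p⟩ ⟨q⟩ hpq
    obtain ⟨l, hp, hq, h⟩ :=
      ((equivalence_exists_comp_eq_comp B g hgcomp).quot_mk_eq_iff _ _).mp hpq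
    obtain ⟨m, hlm, hm⟩ := hstab l
    refine Quot.sound ⟨m, hp.trans hlm, hq.trans hlm, AlgHom.ext fun x => ?_⟩
    have hx := DFunLike.congr_fun h ⟨f l m hlm x, hm ▸ ⟨x, rfl⟩⟩
    change p.2 (f p.1 l hp (f l m hlm x)) = q.2 (f q.1 l hq (f l m hlm x)) at hx
    rwa [hcomp', hcomp'] at hx
  · rintro ⟨i, ψ⟩
    obtain ⟨j, hij, hj⟩ := hstab i
    refine ⟨Quot.mk _ ⟨j, ψ.comp ((f i j hij).codRestrict (Abar i) fun x => hj ▸ ⟨x, rfl⟩)⟩,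
      Quot.sound ⟨j, le_rfl, hij, AlgHom.ext fun x => ?_⟩⟩
    exact congrArg ψ (Subtype.ext (hcomp' i j j hij le_rfl x))
end

section
/- Let B_X and B_Y be counital coalgebras over a field k. Then there exists a counital k-coalgebra H together with bijections Φ_C : Hom_Coalg(C ⊗ B_X, B_Y) ≅ Hom_Coalg(C, H), one for each counital k-coalgebra C, which are natural in C: for every coalgebra homomorphism u : C′ → C and every coalgebra homomorphism ψ : C ⊗ B_X → B_Y one has Φ_{C′}(ψ ∘ (u ⊗ id_{B_X})) = Φ_C(ψ) ∘ u. (In other words, the inner Hom Maps(B_X, B_Y) exists in the symmetric monoidal category of counital k-coalgebras.) -/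
open scoped TensorProduct

/-- A bundled counital coalgebra over a field `k`. -/
structure CoalgCarrier (k : Type) [Field k] : Type 1 where
  carrier : Type
  [isAddCommGroup : AddCommGroup carrier]
  [isModule : Module k carrier]
  [isCoalgebra : Coalgebra k carrier]

attribute [instance] CoalgCarrier.isAddCommGroup CoalgCarrier.isModule
  CoalgCarrier.isCoalgebra

open Coalgebra (comul counit)

namespace CoalgHom

section Factor

variable {R A B C : Type*} [CommSemiring R] [AddCommMonoid A] [Module R A] [AddCommMonoid B]
  [Module R B] [AddCommMonoid C] [Module R C]
  [CoalgebraStruct R A] [CoalgebraStruct R B] [CoalgebraStruct R C]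

/-- A linear map whose composite with a surjective coalgebra homomorphism is a coalgebra
homomorphism is itself a coalgebra homomorphism. -/
def ofSurjective (p : A →ₗc[R] B) (hp : Function.Surjective p) (q : B →ₗ[R] C)
    (r : A →ₗc[R] C) (h : ∀ a, q (p a) = r a) : B →ₗc[R] C where
  toLinearMap := q
  counit_comp := by
    ext b
    obtain ⟨a, rfl⟩ := hp b
    simp [h]
  map_comp_comul := by
    ext b
    obtain ⟨a, rfl⟩ := hp b
    have hqp : q ∘ₗ (p : A →ₗ[R] B) = r := LinearMap.ext h
    have hp' := CoalgHomClass.map_comp_comul_apply p a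
    have hr := CoalgHomClass.map_comp_comul_apply r a
    simp only [LinearMap.comp_apply, h]
    rw [← hp', ← hr, ← LinearMap.comp_apply, ← TensorProduct.map_comp]
    exact congr(TensorProduct.map $hqp $hqp (comul a))

/-- A linear map whose composite with a coalgebra homomorphism `j` is a coalgebra
homomorphism is itself a coalgebra homomorphism, provided that `j ⊗ j` is injective. -/
def ofInjective (j : B →ₗc[R] C)
    (hj : Function.Injective (TensorProduct.map (j : B →ₗ[R] C) (j : B →ₗ[R] C)))
    (m : A →ₗ[R] B) (r : A →ₗc[R] C) (h : ∀ a, j (m a) = r a) : A →ₗc[R] B where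
  toLinearMap := m
  counit_comp := by
    ext a
    rw [LinearMap.comp_apply, ← CoalgHomClass.counit_comp_apply j, h,
      CoalgHomClass.counit_comp_apply]
  map_comp_comul := by
    ext a
    have hjm : (j : B →ₗ[R] C) ∘ₗ m = r := LinearMap.ext h
    apply hj
    have hj' := CoalgHomClass.map_comp_comul_apply j (m a)
    have hr := CoalgHomClass.map_comp_comul_apply r a
    rw [LinearMap.comp_apply, LinearMap.comp_apply, ← LinearMap.comp_apply,
      ← TensorProduct.map_comp, hjm]
    exact hr.trans ((congrArg comul (h a).symm).trans hj'.symm)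

end Factor

section Field

variable {k A B C : Type*} [Field k] [AddCommGroup A] [Module k A] [AddCommGroup B]
  [Module k B] [AddCommGroup C] [Module k C]
  [CoalgebraStruct k A] [CoalgebraStruct k B] [CoalgebraStruct k C]

/-- A coalgebra homomorphism factors through any injective one with larger range. -/
theorem exists_comp_eq_of_range_subset (j : B →ₗc[k] C) (hj : Function.Injective j)
    (r : A →ₗc[k] C) (h : Set.range r ⊆ Set.range j) : ∃ m : A →ₗc[k] B, j.comp m = r := by
  obtain ⟨l, hl⟩ := LinearMap.exists_leftInverse_of_injective (j : B →ₗ[k] C)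
    (LinearMap.ker_eq_bot.mpr hj)
  have hlj (b : B) : l (j b) = b := congr($hl b)
  refine ⟨ofInjective j (TensorProduct.map_injective_of_flat_flat _ _ hj hj)
    (l ∘ₗ (r : A →ₗ[k] C)) r fun a ↦ ?_, ?_⟩
  · obtain ⟨b, hb⟩ := h ⟨a, rfl⟩
    change j (l (r a)) = r a
    rw [← hb, hlj]
  · ext a
    obtain ⟨b, hb⟩ := h ⟨a, rfl⟩
    change j (l (r a)) = r a
    rw [← hb, hlj]

end Field

section Subcoalgebra

variable {k C : Type*} [Field k] [AddCommGroup C] [Module k C] [Coalgebra k C]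

/-- A coalgebra structure pulled back along an injective homomorphism. -/
@[reducible] def _root_.Coalgebra.ofInjective {A : Type*} [AddCommGroup A] [Module k A] [CoalgebraStruct k A]
    (j : A →ₗc[k] C) (hj : Function.Injective j) : Coalgebra k A := by
  have h := CoalgHomClass.map_comp_comul j
  have hε := CoalgHomClass.counit_comp j
  have hj' : Function.Injective (j : A →ₗ[k] C) := hj
  generalize (j : A →ₗ[k] C) = J at h hε hj'
  refine { coassoc := ?_, rTensor_counit_comp_comul := ?_, lTensor_counit_comp_comul := ?_ }
  · have hinj : Function.Injective (TensorProduct.map J (TensorProduct.map J J)) :=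
      TensorProduct.map_injective_of_flat_flat _ _ hj'
        (TensorProduct.map_injective_of_flat_flat _ _ hj' hj')
    rw [← LinearMap.cancel_left hinj, ← LinearMap.comp_assoc,
      TensorProduct.map_map_comp_assoc_eq, LinearMap.comp_assoc,
      ← LinearMap.comp_assoc comul, LinearMap.map_comp_rTensor, h,
      ← LinearMap.comp_assoc comul (LinearMap.lTensor A comul), LinearMap.map_comp_lTensor, h,
      ← LinearMap.rTensor_comp_map, ← LinearMap.lTensor_comp_map, LinearMap.comp_assoc,
      LinearMap.comp_assoc, h]
    simp only [← LinearMap.comp_assoc]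
    rw [← Coalgebra.coassoc]
    rfl
  · have hinj : Function.Injective (J.lTensor k) :=
      Module.Flat.lTensor_preserves_injective_linearMap J hj'
    rw [← LinearMap.cancel_left hinj, ← LinearMap.comp_assoc, LinearMap.lTensor_comp_rTensor,
      ← hε, ← LinearMap.rTensor_comp_map, LinearMap.comp_assoc, h, ← LinearMap.comp_assoc,
      Coalgebra.rTensor_counit_comp_comul]
    rfl
  · have hinj : Function.Injective (J.rTensor k) :=
      Module.Flat.rTensor_preserves_injective_linearMap J hj'
    rw [← LinearMap.cancel_left hinj, ← LinearMap.comp_assoc, LinearMap.rTensor_comp_lTensor,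
      ← hε, ← LinearMap.lTensor_comp_map, LinearMap.comp_assoc, h, ← LinearMap.comp_assoc,
      Coalgebra.lTensor_counit_comp_comul]
    rfl

/-- An injective linear map whose range is stable under comultiplication makes its domain
a coalgebra. -/
theorem exists_coalgebra_of_comul_mem_range {A : Type*} [AddCommGroup A] [Module k A]
    (J : A →ₗ[k] C) (hJ : Function.Injective J)
    (h : ∀ a, comul (J a) ∈ LinearMap.range (TensorProduct.map J J)) :
    ∃ (_ : Coalgebra k A) (j : A →ₗc[k] C), ∀ a, j a = J a := by
  let e := LinearEquiv.ofInjective (TensorProduct.map J J)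
    (TensorProduct.map_injective_of_flat_flat _ _ hJ hJ)
  let _ : CoalgebraStruct k A :=
    { comul := e.symm ∘ₗ (comul ∘ₗ J).codRestrict _ h
      counit := counit ∘ₗ J }
  let j : A →ₗc[k] C :=
    { toLinearMap := J
      counit_comp := rfl
      map_comp_comul := by
        ext a
        exact congrArg Subtype.val (e.apply_symm_apply ⟨comul (J a), h a⟩) }
  exact ⟨Coalgebra.ofInjective j hJ, j, fun _ ↦ rfl⟩

/-- Every countable subset of a coalgebra lies in a countable set whose span is stable under
comultiplication. -/
theorem exists_countable_superset_comul_mem (s : Set C) (hs : s.Countable) :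
    ∃ t : Set C, s ⊆ t ∧ t.Countable ∧ ∀ x ∈ Submodule.span k t,
      comul x ∈ LinearMap.range
        (TensorProduct.mapIncl (Submodule.span k t) (Submodule.span k t)) := by
  have hF (x : C) : ∃ F : Set C, F.Countable ∧ ∀ t, F ⊆ t → comul x ∈ LinearMap.range
      (TensorProduct.mapIncl (Submodule.span k t) (Submodule.span k t)) := by
    obtain ⟨M, N, hM, hN, hMN⟩ := TensorProduct.exists_finite_submodule_of_setFinite
      {comul (R := k) x} (Set.finite_singleton _)
    rw [Module.Finite.iff_fg] at hM hN
    obtain ⟨a, rfl⟩ := hM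
    obtain ⟨b, rfl⟩ := hN
    refine ⟨a ∪ b, (a.countable_toSet.union b.countable_toSet), fun t ht ↦ ?_⟩
    exact TensorProduct.range_mapIncl_mono
      (Submodule.span_mono (Set.subset_union_left.trans ht))
      (Submodule.span_mono (Set.subset_union_right.trans ht)) (hMN rfl)
  choose F hFc hF using hF
  let T : ℕ → Set C := fun n ↦ n.rec s fun _ U ↦ ⋃ x ∈ U, F x
  have hT (n : ℕ) : (T n).Countable := by
    induction n with
    | zero => exact hs
    | succ n ih => exact ih.biUnion fun x _ ↦ hFc x
  refine ⟨⋃ n, T n, Set.subset_iUnion T 0, Set.countable_iUnion hT, fun x hx ↦ ?_⟩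
  induction hx using Submodule.span_induction with
  | mem x hx =>
    obtain ⟨n, hn⟩ := Set.mem_iUnion.mp hx
    exact hF x _ ((Set.subset_biUnion_of_mem (u := F) hn).trans (Set.subset_iUnion T (n + 1)))
  | zero => simp
  | add x y _ _ hx hy => simpa using add_mem hx hy
  | smul c x _ hx => simpa using Submodule.smul_mem _ c hx

/-- Every countable subset of a coalgebra lies in a subcoalgebra of countable dimension, which
can be modelled on a quotient of `ℕ →₀ k`. -/
theorem exists_injective_coalgHom_of_countable (s : Set C) (hs : s.Countable) :
    ∃ (K : Submodule k (ℕ →₀ k)) (_ : Coalgebra k ((ℕ →₀ k) ⧸ K))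
      (j : ((ℕ →₀ k) ⧸ K) →ₗc[k] C), Function.Injective j ∧ s ⊆ Set.range j := by
  obtain ⟨t, hst, ht, hcomul⟩ := exists_countable_superset_comul_mem (k := k) (insert 0 s)
    (hs.insert 0)
  obtain ⟨e, rfl⟩ := ht.exists_eq_range ⟨0, hst (Set.mem_insert _ _)⟩
  let g := Finsupp.linearCombination k e
  let J := (LinearMap.ker g).liftQ g le_rfl
  have hJ : Function.Injective J :=
    LinearMap.ker_eq_bot.mp (Submodule.ker_liftQ_eq_bot _ _ _ le_rfl)
  have hrange : LinearMap.range J = Submodule.span k (Set.range e) := by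
    rw [Submodule.range_liftQ, Finsupp.range_linearCombination]
  rw [← hrange] at hcomul
  obtain ⟨c, j, hj⟩ := exists_coalgebra_of_comul_mem_range J hJ fun a ↦ by
    have := hcomul (J a) ⟨a, rfl⟩
    rwa [TensorProduct.range_mapIncl, ← TensorProduct.range_map] at this
  refine ⟨_, c, j, fun a b hab ↦ hJ (by rwa [hj, hj] at hab), fun x hx ↦ ?_⟩
  obtain ⟨a, ha⟩ : x ∈ LinearMap.range J :=
    hrange ▸ Submodule.subset_span (hst (Set.mem_insert_of_mem _ hx))
  exact ⟨a, (hj a).trans ha⟩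

end Subcoalgebra

section Pairing

universe w

variable {k X Y : Type*} [Field k] [AddCommGroup X] [Module k X] [Coalgebra k X]
  [AddCommGroup Y] [Module k Y] [Coalgebra k Y]

/-- A family of homomorphisms `D i ⊗ X → Y` assembles to one on the direct sum of the `D i`. -/
theorem exists_dfinsupp_pairing {ι : Type*} [DecidableEq ι] {D : ι → Type*}
    [∀ i, AddCommGroup (D i)] [∀ i, Module k (D i)] [∀ i, Coalgebra k (D i)]
    (ψ : ∀ i, (D i ⊗[k] X) →ₗc[k] Y) :
    ∃ Ψ : ((Π₀ i, D i) ⊗[k] X) →ₗc[k] Y,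
      ∀ i d x, Ψ (DFinsupp.single i d ⊗ₜ x) = ψ i (d ⊗ₜ x) := by
  let L : ((Π₀ i, D i) ⊗[k] X) →ₗ[k] Y := TensorProduct.lift
    (DFinsupp.lsum k fun i ↦ TensorProduct.curry (ψ i : (D i ⊗[k] X) →ₗ[k] Y))
  have hL (i d x) : L (DFinsupp.single i d ⊗ₜ x) = ψ i (d ⊗ₜ x) := by
    simp [L]
  let single (i) : D i →ₗc[k] Π₀ i, D i :=
    ⟨DFinsupp.lsingle i, DFinsupp.counit_comp_lsingle k ι D i,
      (DFinsupp.comul_comp_lsingle k ι D i).symm⟩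
  let u (i) := Coalgebra.TensorProduct.map (single i) (CoalgHom.id k X)
  have hu (i) : L ∘ₗ (u i : (D i ⊗[k] X) →ₗ[k] _) = ψ i := by
    ext d x
    exact hL i d x
  refine ⟨⟨L, ?_, ?_⟩, hL⟩
  · ext i d x
    have h₁ := CoalgHomClass.counit_comp_apply (ψ i) (d ⊗ₜ[k] x)
    have h₂ := CoalgHomClass.counit_comp_apply (u i) (d ⊗ₜ[k] x)
    rw [← hL] at h₁
    exact h₁.trans h₂.symm
  · ext i d x
    have h₁ := CoalgHomClass.map_comp_comul_apply (ψ i) (d ⊗ₜ[k] x)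
    have h₂ := CoalgHomClass.map_comp_comul_apply (u i) (d ⊗ₜ[k] x)
    rw [← hL] at h₁
    refine Eq.trans ?_ h₁
    change TensorProduct.map L L (comul (u i (d ⊗ₜ[k] x))) = _
    rw [← h₂, ← LinearMap.comp_apply, ← TensorProduct.map_comp]
    exact congr(TensorProduct.map $(hu i) $(hu i) (comul (d ⊗ₜ[k] x)))

variable {T : Type*} [AddCommGroup T] [Module k T] [Coalgebra k T]

/-- A homomorphism `T ⊗ X → Y` descends to the quotient of `T` by a coideal `I` if it vanishes
on `I ⊗ X`. -/
theorem exists_quotient_pairing (Ψ : (T ⊗[k] X) →ₗc[k] Y) (I : Submodule k T) [I.IsCoideal]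
    (hI : ∀ t ∈ I, ∀ x, Ψ (t ⊗ₜ x) = 0) :
    ∃ Ψ' : ((T ⧸ I) ⊗[k] X) →ₗc[k] Y, ∀ t x, Ψ' (I.mkQ t ⊗ₜ x) = Ψ (t ⊗ₜ x) := by
  let p := Coalgebra.TensorProduct.map (Coalgebra.Quotient.mkQCoalgHom (R := k) I)
    (CoalgHom.id k X)
  let q : ((T ⧸ I) ⊗[k] X) →ₗ[k] Y := TensorProduct.lift
    (I.liftQ (TensorProduct.curry (Ψ : (T ⊗[k] X) →ₗ[k] Y)) fun t ht ↦ by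
      ext x
      exact hI t ht x)
  have hq : q ∘ₗ (p : (T ⊗[k] X) →ₗ[k] _) = Ψ := by
    ext t x
    rfl
  exact ⟨ofSurjective p (TensorProduct.map_surjective I.mkQ_surjective Function.surjective_id)
    q Ψ fun a ↦ congr($hq a), fun _ _ ↦ rfl⟩

/-- The sum of all members of a family of coideals is a coideal. -/
theorem _root_.Submodule.isCoideal_sSup (S : Set (Submodule k T)) (hS : ∀ I ∈ S, I.IsCoideal) :
    (sSup S).IsCoideal := by
  have h : sSup S ≤ LinearMap.ker (counit : T →ₗ[k] k) ⊓
      LinearMap.ker (TensorProduct.map (sSup S).mkQ (sSup S).mkQ ∘ₗ (comul : T →ₗ[k] _)) := by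
    refine sSup_le fun I hI x hx ↦ ⟨(hS I hI).counit_eq_zero hx, ?_⟩
    have hle : I ≤ sSup S := le_sSup hI
    have hfac : (sSup S).mkQ = Submodule.factor hle ∘ₗ I.mkQ := by
      ext
      rfl
    rw [SetLike.mem_coe, LinearMap.mem_ker, LinearMap.comp_apply, hfac, TensorProduct.map_comp,
      LinearMap.comp_apply, (hS I hI).map_mkQ_comul_eq_zero hx, map_zero]
  exact ⟨fun x hx ↦ (h hx).1, fun x hx ↦ (h hx).2⟩

/-- The preimage under a quotient homomorphism of the range of a difference of two coalgebra
homomorphisms is a coideal. -/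
theorem _root_.Submodule.isCoideal_comap_range_sub {C : Type*} [AddCommGroup C] [Module k C]
    [Coalgebra k C] (I : Submodule k T) [I.IsCoideal] (f g : C →ₗc[k] T ⧸ I) :
    ((LinearMap.range ((f : C →ₗ[k] T ⧸ I) - (g : C →ₗ[k] T ⧸ I))).comap I.mkQ).IsCoideal := by
  set J := (LinearMap.range ((f : C →ₗ[k] T ⧸ I) - (g : C →ₗ[k] T ⧸ I))).comap I.mkQ with hJ
  have hIJ : I ≤ J := fun x hx ↦ by
    rw [hJ, Submodule.mem_comap, Submodule.mkQ_apply, (Submodule.Quotient.mk_eq_zero I).mpr hx]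
    exact zero_mem _
  let p : (T ⧸ I) →ₗ[k] T ⧸ J := Submodule.factor hIJ
  have hp : J.mkQ = p ∘ₗ I.mkQ := by
    ext
    rfl
  have hpfg : p ∘ₗ (f : C →ₗ[k] T ⧸ I) = p ∘ₗ (g : C →ₗ[k] T ⧸ I) := by
    ext c
    obtain ⟨t, ht⟩ := I.mkQ_surjective (f c - g c)
    have htJ : t ∈ J := ⟨c, ht.symm⟩
    have : p (f c - g c) = 0 := by
      rw [← ht, ← LinearMap.comp_apply, ← hp]
      exact (Submodule.Quotient.mk_eq_zero J).mpr htJ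
    rwa [map_sub, sub_eq_zero] at this
  refine ⟨fun x hx ↦ ?_, fun x hx ↦ ?_⟩ <;> obtain ⟨c, hc⟩ := hx <;>
    replace hc : f c - g c = I.mkQ x := hc
  · have : counit (R := k) (I.mkQ x) = counit x := rfl
    rw [← this, ← hc, map_sub, CoalgHomClass.counit_comp_apply, CoalgHomClass.counit_comp_apply,
      sub_self]
  · have : TensorProduct.map I.mkQ I.mkQ (comul x) = comul (R := k) (I.mkQ x) := rfl
    rw [hp, TensorProduct.map_comp, LinearMap.comp_apply, this, ← hc, map_sub, map_sub,
      ← CoalgHomClass.map_comp_comul_apply f, ← CoalgHomClass.map_comp_comul_apply g, sub_eq_zero,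
      TensorProduct.map_map, TensorProduct.map_map]
    exact congr(TensorProduct.map $hpfg $hpfg (comul c))

/-- Every homomorphism `T ⊗ X → Y` descends to a quotient coalgebra of `T` on which it separates
coalgebra homomorphisms. -/
theorem exists_separating_quotient (Ψ : (T ⊗[k] X) →ₗc[k] Y) :
    ∃ (I : Submodule k T) (_ : I.IsCoideal) (Ψ' : ((T ⧸ I) ⊗[k] X) →ₗc[k] Y),
      (∀ t x, Ψ' (I.mkQ t ⊗ₜ x) = Ψ (t ⊗ₜ x)) ∧
      ∀ (C : Type w) [AddCommGroup C] [Module k C] [Coalgebra k C] (f g : C →ₗc[k] T ⧸ I),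
        (∀ c x, Ψ' (f c ⊗ₜ x) = Ψ' (g c ⊗ₜ x)) → f = g := by
  let S : Set (Submodule k T) := {I | I.IsCoideal ∧ ∀ t ∈ I, ∀ x, Ψ (t ⊗ₜ x) = 0}
  have hS : (sSup S).IsCoideal := Submodule.isCoideal_sSup S fun I hI ↦ hI.1
  have hΨ : sSup S ≤ LinearMap.ker (TensorProduct.curry (Ψ : (T ⊗[k] X) →ₗ[k] Y)) :=
    sSup_le fun I hI t ht ↦ by
      ext x
      exact hI.2 t ht x
  obtain ⟨Ψ', hΨ'⟩ := exists_quotient_pairing Ψ (sSup S) fun t ht x ↦ congr($(hΨ ht) x)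
  refine ⟨sSup S, hS, Ψ', hΨ', fun C _ _ _ f g hfg ↦ ?_⟩
  ext c
  obtain ⟨t, ht⟩ := (sSup S).mkQ_surjective (f c - g c)
  have hmem : (LinearMap.range ((f : C →ₗ[k] T ⧸ sSup S) - (g : C →ₗ[k] T ⧸ sSup S))).comap
      (sSup S).mkQ ∈ S := by
    refine ⟨Submodule.isCoideal_comap_range_sub _ f g, fun t ht x ↦ ?_⟩
    obtain ⟨c, hc⟩ := ht
    replace hc : f c - g c = (sSup S).mkQ t := hc
    rw [← hΨ', ← hc, TensorProduct.sub_tmul, map_sub, hfg, sub_self]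
  have htS : t ∈ sSup S := le_sSup hmem ⟨c, ht.symm⟩
  rw [← sub_eq_zero, ← ht]
  exact (Submodule.Quotient.mk_eq_zero _).mpr htS

end Pairing

section InnerHom

/-- A coalgebra structure `A` on a quotient of `ℕ →₀ k` together with a homomorphism
`A ⊗ X → Y`. -/
structure CountablePairing (k X Y : Type) [Field k] [AddCommGroup X] [Module k X] [Coalgebra k X]
    [AddCommGroup Y] [Module k Y] [Coalgebra k Y] : Type where
  ker : Submodule k (ℕ →₀ k)
  [coalgebra : Coalgebra k ((ℕ →₀ k) ⧸ ker)]
  pairing : (((ℕ →₀ k) ⧸ ker) ⊗[k] X) →ₗc[k] Y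

attribute [instance] CountablePairing.coalgebra

variable {k X Y : Type} [Field k] [AddCommGroup X] [Module k X] [Coalgebra k X]
  [AddCommGroup Y] [Module k Y] [Coalgebra k Y]

/-- Every small family of homomorphisms `D i ⊗ X → Y` factors through a single separating
homomorphism `H ⊗ X → Y`. -/
theorem exists_separating_pairing {ι : Type} {D : ι → Type}
    [∀ i, AddCommGroup (D i)] [∀ i, Module k (D i)] [∀ i, Coalgebra k (D i)]
    (ψ : ∀ i, (D i ⊗[k] X) →ₗc[k] Y) :
    ∃ (H : CoalgCarrier k) (Ψ : (H.carrier ⊗[k] X) →ₗc[k] Y),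
      (∀ i, ∃ f : D i →ₗc[k] H.carrier, ∀ a x, Ψ (f a ⊗ₜ x) = ψ i (a ⊗ₜ x)) ∧
      ∀ (C : Type) [AddCommGroup C] [Module k C] [Coalgebra k C] (f g : C →ₗc[k] H.carrier),
        (∀ c x, Ψ (f c ⊗ₜ x) = Ψ (g c ⊗ₜ x)) → f = g := by
  classical
  obtain ⟨Ψ, hΨ⟩ := exists_dfinsupp_pairing ψ
  obtain ⟨I, hI, Ψ', hΨ', hsep⟩ := exists_separating_quotient Ψ
  refine ⟨⟨(Π₀ i, D i) ⧸ I⟩, Ψ', fun i ↦ ?_, hsep⟩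
  refine ⟨(Coalgebra.Quotient.mkQCoalgHom (R := k) I).comp
    ⟨DFinsupp.lsingle i, DFinsupp.counit_comp_lsingle k ι D i,
      (DFinsupp.comul_comp_lsingle k ι D i).symm⟩, fun a x ↦ ?_⟩
  exact (hΨ' _ x).trans (hΨ i a x)

/-- Two homomorphisms out of quotients of `ℕ →₀ k` land in a common larger subcoalgebra. -/
theorem exists_injective_coalgHom_range_union {C : Type*} [AddCommGroup C] [Module k C]
    [Coalgebra k C] {K₁ K₂ : Submodule k (ℕ →₀ k)}
    [Coalgebra k ((ℕ →₀ k) ⧸ K₁)] [Coalgebra k ((ℕ →₀ k) ⧸ K₂)]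
    (j₁ : ((ℕ →₀ k) ⧸ K₁) →ₗc[k] C) (j₂ : ((ℕ →₀ k) ⧸ K₂) →ₗc[k] C) :
    ∃ (K : Submodule k (ℕ →₀ k)) (_ : Coalgebra k ((ℕ →₀ k) ⧸ K))
      (j : ((ℕ →₀ k) ⧸ K) →ₗc[k] C), Function.Injective j ∧
        Set.range j₁ ⊆ Set.range j ∧ Set.range j₂ ⊆ Set.range j := by
  obtain ⟨K, c, j, hj, hs⟩ := exists_injective_coalgHom_of_countable (k := k)
    (Set.range (fun n ↦ j₁ (K₁.mkQ (Finsupp.single n 1))) ∪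
      Set.range (fun n ↦ j₂ (K₂.mkQ (Finsupp.single n 1))))
    ((Set.countable_range _).union (Set.countable_range _))
  have key {K' : Submodule k (ℕ →₀ k)} [Coalgebra k ((ℕ →₀ k) ⧸ K')]
      (j' : ((ℕ →₀ k) ⧸ K') →ₗc[k] C)
      (h : Set.range (fun n ↦ j' (K'.mkQ (Finsupp.single n 1))) ⊆ Set.range j) :
      Set.range j' ⊆ Set.range j := by
    rintro _ ⟨a, rfl⟩
    obtain ⟨v, rfl⟩ := K'.mkQ_surjective a
    change j' (K'.mkQ v) ∈ LinearMap.range (j : ((ℕ →₀ k) ⧸ K) →ₗ[k] C)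
    induction v using Finsupp.induction_linear with
    | zero => simp
    | add v w hv hw => simpa only [map_add] using add_mem hv hw
    | single n r =>
      rw [← mul_one r, ← smul_eq_mul, ← Finsupp.smul_single, map_smul, map_smul]
      exact Submodule.smul_mem _ r (h ⟨n, rfl⟩)
  exact ⟨K, c, j, hj, key j₁ (Set.subset_union_left.trans hs),
    key j₂ (Set.subset_union_right.trans hs)⟩

/-- A separating homomorphism `H ⊗ X → Y` which is universal for coalgebras on quotients of
`ℕ →₀ k` is universal for all coalgebras. -/
theorem exists_lift_of_separating (H : CoalgCarrier k) (Ψ : (H.carrier ⊗[k] X) →ₗc[k] Y)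
    (hlift : ∀ s : CountablePairing k X Y, ∃ f : ((ℕ →₀ k) ⧸ s.ker) →ₗc[k] H.carrier,
      ∀ a x, Ψ (f a ⊗ₜ x) = s.pairing (a ⊗ₜ x))
    (hsep : ∀ (C : Type) [AddCommGroup C] [Module k C] [Coalgebra k C]
      (f g : C →ₗc[k] H.carrier), (∀ c x, Ψ (f c ⊗ₜ x) = Ψ (g c ⊗ₜ x)) → f = g)
    {C : Type} [AddCommGroup C] [Module k C] [Coalgebra k C] (ψ : (C ⊗[k] X) →ₗc[k] Y) :
    ∃ f : C →ₗc[k] H.carrier, ∀ c x, Ψ (f c ⊗ₜ x) = ψ (c ⊗ₜ x) := by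
  have hloc (K : Submodule k (ℕ →₀ k)) [Coalgebra k ((ℕ →₀ k) ⧸ K)]
      (j : ((ℕ →₀ k) ⧸ K) →ₗc[k] C) :
      ∃ f : ((ℕ →₀ k) ⧸ K) →ₗc[k] H.carrier, ∀ a x, Ψ (f a ⊗ₜ x) = ψ (j a ⊗ₜ x) :=
    hlift ⟨K, ψ.comp (Coalgebra.TensorProduct.map j (CoalgHom.id k X))⟩
  have hagree {K₁ K₂ : Submodule k (ℕ →₀ k)}
      [Coalgebra k ((ℕ →₀ k) ⧸ K₁)] [Coalgebra k ((ℕ →₀ k) ⧸ K₂)]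
      (j₁ : ((ℕ →₀ k) ⧸ K₁) →ₗc[k] C) (j₂ : ((ℕ →₀ k) ⧸ K₂) →ₗc[k] C)
      (f₁ : ((ℕ →₀ k) ⧸ K₁) →ₗc[k] H.carrier) (f₂ : ((ℕ →₀ k) ⧸ K₂) →ₗc[k] H.carrier)
      (h₁ : ∀ a x, Ψ (f₁ a ⊗ₜ x) = ψ (j₁ a ⊗ₜ x)) (h₂ : ∀ a x, Ψ (f₂ a ⊗ₜ x) = ψ (j₂ a ⊗ₜ x))
      (a₁ : (ℕ →₀ k) ⧸ K₁) (a₂ : (ℕ →₀ k) ⧸ K₂) (ha : j₁ a₁ = j₂ a₂) : f₁ a₁ = f₂ a₂ := by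
    obtain ⟨K, _, j, hj, hr₁, hr₂⟩ := exists_injective_coalgHom_range_union j₁ j₂
    obtain ⟨f, hf⟩ := hloc K j
    obtain ⟨m₁, rfl⟩ := exists_comp_eq_of_range_subset j hj j₁ hr₁
    obtain ⟨m₂, rfl⟩ := exists_comp_eq_of_range_subset j hj j₂ hr₂
    rw [hsep _ f₁ (f.comp m₁) fun a x ↦ (h₁ a x).trans (hf _ x).symm,
      hsep _ f₂ (f.comp m₂) fun a x ↦ (h₂ a x).trans (hf _ x).symm]
    exact congrArg f (hj ha)
  have hcover (c : C) := exists_injective_coalgHom_of_countable (k := k) {c}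
    (Set.countable_singleton c)
  choose K cK j hj hc using hcover
  choose e he using fun c ↦ hc c rfl
  choose f hf using fun c ↦ hloc (K c) (j c)
  let F : C → H.carrier := fun c ↦ f c (e c)
  have hF {K' : Submodule k (ℕ →₀ k)} [Coalgebra k ((ℕ →₀ k) ⧸ K')]
      (j' : ((ℕ →₀ k) ⧸ K') →ₗc[k] C) (f' : ((ℕ →₀ k) ⧸ K') →ₗc[k] H.carrier)
      (h' : ∀ a x, Ψ (f' a ⊗ₜ x) = ψ (j' a ⊗ₜ x)) (a : (ℕ →₀ k) ⧸ K') : F (j' a) = f' a :=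
    hagree _ j' _ f' (hf _) h' _ a (he _)
  let L : C →ₗ[k] H.carrier :=
    { toFun := F
      map_add' := fun c d ↦ by
        obtain ⟨K', _, j', hj', hr₁, hr₂⟩ := exists_injective_coalgHom_range_union (j c) (j d)
        obtain ⟨f', hf'⟩ := hloc K' j'
        obtain ⟨a, rfl⟩ : c ∈ Set.range j' := hr₁ ⟨_, he c⟩
        obtain ⟨b, rfl⟩ : d ∈ Set.range j' := hr₂ ⟨_, he d⟩
        rw [← map_add, hF j' f' hf', hF j' f' hf', hF j' f' hf', map_add]
      map_smul' := fun r c ↦ by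
        rw [← he c, ← map_smul, hF _ _ (hf c), hF _ _ (hf c), map_smul, RingHom.id_apply] }
  have hL (c : C) : L ∘ₗ (j c : _ →ₗ[k] C) = f c := LinearMap.ext fun a ↦ hF _ _ (hf c) a
  refine ⟨⟨L, ?_, ?_⟩, fun c x ↦ (hf c (e c) x).trans (by rw [he])⟩
  · ext c
    have h₁ := CoalgHomClass.counit_comp_apply (f c) (e c)
    have h₂ := CoalgHomClass.counit_comp_apply (j c) (e c)
    rw [he] at h₂
    exact h₁.trans h₂.symm
  · ext c
    have h₁ := CoalgHomClass.map_comp_comul_apply (f c) (e c)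
    have h₂ := CoalgHomClass.map_comp_comul_apply (j c) (e c)
    rw [he] at h₂
    refine Eq.trans ?_ h₁
    rw [LinearMap.comp_apply, ← h₂, ← LinearMap.comp_apply, ← TensorProduct.map_comp]
    exact congr(TensorProduct.map $(hL c) $(hL c) (comul (e c)))

end InnerHom

end CoalgHom

/-- **Existence of the inner Hom of counital coalgebras** (`Maps(X, Y)`): for counital
coalgebras `B_X`, `B_Y` over a field `k` there is a counital coalgebra `H` together with
bijections `Hom_Coalg(C ⊗ B_X, B_Y) ≅ Hom_Coalg(C, H)`, natural in the counital
coalgebra `C`. -/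
theorem exists_inner_hom_coalgebra (k BX BY : Type) [Field k]
    [AddCommGroup BX] [Module k BX] [Coalgebra k BX]
    [AddCommGroup BY] [Module k BY] [Coalgebra k BY] :
    ∃ (H : CoalgCarrier k)
      (Φ : ∀ C : CoalgCarrier k,
        ((C.carrier ⊗[k] BX) →ₗc[k] BY) ≃ (C.carrier →ₗc[k] H.carrier)),
      ∀ (C C' : CoalgCarrier k) (u : C'.carrier →ₗc[k] C.carrier)
        (ψ : (C.carrier ⊗[k] BX) →ₗc[k] BY),
        Φ C' (ψ.comp (Coalgebra.TensorProduct.map u (CoalgHom.id k BX))) =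
          (Φ C ψ).comp u := by
  obtain ⟨H, Ψ, hlift, hsep⟩ := CoalgHom.exists_separating_pairing
    (D := fun s : CoalgHom.CountablePairing k BX BY ↦ (ℕ →₀ k) ⧸ s.ker) fun s ↦ s.pairing
  let pull (C : CoalgCarrier k) (f : C.carrier →ₗc[k] H.carrier) :
      (C.carrier ⊗[k] BX) →ₗc[k] BY :=
    Ψ.comp (Coalgebra.TensorProduct.map f (CoalgHom.id k BX))
  have hpull (C : CoalgCarrier k) : Function.Bijective (pull C) := by
    refine ⟨fun f g hfg ↦ hsep _ f g fun c x ↦ congr($hfg (c ⊗ₜ x)), fun ψ ↦ ?_⟩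
    obtain ⟨f, hf⟩ := CoalgHom.exists_lift_of_separating H Ψ hlift hsep ψ
    refine ⟨f, DFunLike.ext _ _ fun t ↦ ?_⟩
    have : (pull C f : (C.carrier ⊗[k] BX) →ₗ[k] BY) = ψ := TensorProduct.ext' hf
    exact congr($this t)
  refine ⟨H, fun C ↦ (Equiv.ofBijective (pull C) (hpull C)).symm, fun C C' u ψ ↦ ?_⟩
  obtain ⟨f, rfl⟩ := (hpull C).2 ψ
  have hcomp : (pull C f).comp (Coalgebra.TensorProduct.map u (CoalgHom.id k BX)) =
      pull C' (f.comp u) := by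
    refine DFunLike.ext _ _ fun t ↦ ?_
    induction t using TensorProduct.induction_on with
    | zero => simp
    | tmul c x => rfl
    | add s t hs ht => rw [map_add, map_add, hs, ht]
  rw [hcomp, Equiv.symm_apply_eq, Equiv.ofBijective_apply]
  congr 2
  exact ((Equiv.ofBijective (pull C) (hpull C)).symm_apply_apply f).symm
end

section
/- Let f : C₁ → C₂ be a minimal conilpotent extension of counital coalgebras over a field k and let D be any counital k-coalgebra. Then f ⊗ id_D : C₁ ⊗ D → C₂ ⊗ D is a minimal conilpotent extension of the tensor-product coalgebras. Consequently, if f : C₁ → C₂ is a conilpotent extension then so is f ⊗ id_D : C₁ ⊗ D → C₂ ⊗ D. -/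
open scoped TensorProduct

/-- An injective coalgebra homomorphism `f : C → D` is a minimal conilpotent extension if
`Δ(D) ⊆ f(C) ⊗ D + D ⊗ f(C)` inside `D ⊗ D`. -/
def IsMinimalConilpotentExtension {k C D : Type} [Field k]
    [AddCommGroup C] [Module k C] [Coalgebra k C]
    [AddCommGroup D] [Module k D] [Coalgebra k D] (f : C →ₗc[k] D) : Prop :=
  Function.Injective f ∧
  ∀ x : D, Coalgebra.comul (R := k) x ∈
    LinearMap.range (TensorProduct.map f.toLinearMap (LinearMap.id : D →ₗ[k] D)) ⊔
    LinearMap.range (TensorProduct.map (LinearMap.id : D →ₗ[k] D) f.toLinearMap)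

/-- `IsConilpotentChain k n C D f` says that `f` is a composition of `n + 1` minimal
conilpotent extensions. -/
def IsConilpotentChain (k : Type) [Field k] :
    ℕ → ∀ (C D : Type) [AddCommGroup C] [Module k C] [Coalgebra k C]
      [AddCommGroup D] [Module k D] [Coalgebra k D], (C →ₗc[k] D) → Prop
  | 0 => fun C D [AddCommGroup C] [Module k C] [Coalgebra k C]
      [AddCommGroup D] [Module k D] [Coalgebra k D] f => IsMinimalConilpotentExtension f
  | n + 1 => fun C D [AddCommGroup C] [Module k C] [Coalgebra k C]
      [AddCommGroup D] [Module k D] [Coalgebra k D] f =>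
      ∃ (E : CoalgCarrier k) (g : C →ₗc[k] E.carrier) (h : E.carrier →ₗc[k] D),
        IsConilpotentChain k n C E.carrier g ∧ IsMinimalConilpotentExtension h ∧
        f = h.comp g

/-- A conilpotent extension is a finite composition of minimal conilpotent extensions. -/
def IsConilpotentExtension {k C D : Type} [Field k]
    [AddCommGroup C] [Module k C] [Coalgebra k C]
    [AddCommGroup D] [Module k D] [Coalgebra k D] (f : C →ₗc[k] D) : Prop :=
  ∃ n : ℕ, IsConilpotentChain k n C D f

/-- Tensoring a minimal conilpotent extension with a coalgebra is a minimal conilpotent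
extension. -/
theorem IsMinimalConilpotentExtension.tensorProduct_map_id {k C₁ C₂ : Type} (D : Type) [Field k]
    [AddCommGroup C₁] [Module k C₁] [Coalgebra k C₁]
    [AddCommGroup C₂] [Module k C₂] [Coalgebra k C₂]
    [AddCommGroup D] [Module k D] [Coalgebra k D]
    {f : C₁ →ₗc[k] C₂} (hf : IsMinimalConilpotentExtension f) :
    IsMinimalConilpotentExtension (Coalgebra.TensorProduct.map f (CoalgHom.id k D)) := by
  obtain ⟨hinj, hcomul⟩ := hf
  refine ⟨Module.Flat.rTensor_preserves_injective_linearMap (M := D) f.toLinearMap hinj, ?_⟩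
  intro x
  induction x with
  | zero => rw [map_zero]; exact Submodule.zero_mem _
  | add x y hx hy => rw [map_add]; exact Submodule.add_mem _ hx hy
  | tmul c d =>
    rw [TensorProduct.comul_tmul]
    obtain ⟨_, ⟨u, rfl⟩, _, ⟨v, rfl⟩, huv⟩ := Submodule.mem_sup.mp (hcomul c)
    rw [← huv, TensorProduct.add_tmul, map_add]
    clear huv
    generalize Coalgebra.comul (R := k) d = w
    refine Submodule.add_mem_sup ?_ ?_
    · refine ⟨TensorProduct.AlgebraTensorModule.tensorTensorTensorComm k k k k C₁ C₂ D D
        (u ⊗ₜ w), ?_⟩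
      induction u with
      | zero => simp
      | add a b ha hb => simp only [TensorProduct.add_tmul, map_add, ha, hb]
      | tmul a b =>
        induction w with
        | zero => simp
        | add p q hp hq => simp only [TensorProduct.tmul_add, map_add, hp, hq]
        | tmul p q => rfl
    · refine ⟨TensorProduct.AlgebraTensorModule.tensorTensorTensorComm k k k k C₂ C₁ D D
        (v ⊗ₜ w), ?_⟩
      induction v with
      | zero => simp
      | add a b ha hb => simp only [TensorProduct.add_tmul, map_add, ha, hb]
      | tmul a b =>
        induction w with
        | zero => simp
        | add p q hp hq => simp only [TensorProduct.tmul_add, map_add, hp, hq]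
        | tmul p q => rfl

/-- Tensoring a composition of minimal conilpotent extensions with a coalgebra is a composition of
as many minimal conilpotent extensions. -/
theorem IsConilpotentChain.tensorProduct_map_id {k : Type} (D : Type) [Field k]
    [AddCommGroup D] [Module k D] [Coalgebra k D] (n : ℕ) {C₁ C₂ : Type}
    [AddCommGroup C₁] [Module k C₁] [Coalgebra k C₁]
    [AddCommGroup C₂] [Module k C₂] [Coalgebra k C₂]
    {f : C₁ →ₗc[k] C₂} (hf : IsConilpotentChain k n C₁ C₂ f) :
    IsConilpotentChain k n (C₁ ⊗[k] D) (C₂ ⊗[k] D)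
      (Coalgebra.TensorProduct.map f (CoalgHom.id k D)) := by
  induction n generalizing C₁ C₂ with
  | zero => exact IsMinimalConilpotentExtension.tensorProduct_map_id D hf
  | succ n ih =>
    obtain ⟨E, g, h, hg, hh, rfl⟩ := hf
    refine ⟨⟨E.carrier ⊗[k] D⟩, Coalgebra.TensorProduct.map g (CoalgHom.id k D),
      Coalgebra.TensorProduct.map h (CoalgHom.id k D), ih hg, hh.tensorProduct_map_id D, ?_⟩
    ext x
    induction x with
    | zero => simp only [map_zero]
    | add x y hx hy => simp only [map_add, hx, hy]
    | tmul c d => rfl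

/-- **Tensoring a (minimal) conilpotent extension with a coalgebra preserves it**: if
`f : C₁ → C₂` is a minimal conilpotent extension of counital coalgebras over a field `k`
and `D` is any counital coalgebra, then `f ⊗ id_D : C₁ ⊗ D → C₂ ⊗ D` is a minimal
conilpotent extension; consequently if `f` is a conilpotent extension then so is
`f ⊗ id_D`. -/
theorem tensorProduct_conilpotent_extension
    (k C₁ C₂ D : Type) [Field k]
    [AddCommGroup C₁] [Module k C₁] [Coalgebra k C₁]
    [AddCommGroup C₂] [Module k C₂] [Coalgebra k C₂]
    [AddCommGroup D] [Module k D] [Coalgebra k D]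
    (f : C₁ →ₗc[k] C₂) :
    (IsMinimalConilpotentExtension f →
      IsMinimalConilpotentExtension (Coalgebra.TensorProduct.map f (CoalgHom.id k D))) ∧
    (IsConilpotentExtension f →
      IsConilpotentExtension (Coalgebra.TensorProduct.map f (CoalgHom.id k D))) := by
  exact ⟨fun hf => hf.tensorProduct_map_id D,
    fun ⟨n, hn⟩ => ⟨n, hn.tensorProduct_map_id D⟩⟩
end

section
/- Let B_X and B_Y be counital coalgebras over a field k, with B_Y smooth, and let H be an inner Hom from B_X to B_Y (a counital coalgebra equipped with bijections Φ_C : Hom_Coalg(C ⊗ B_X, B_Y) ≅ Hom_Coalg(C, H), natural in the counital coalgebra C). Then H is smooth. -/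
open scoped TensorProduct

/-- A counital coalgebra `B` over `k` is smooth if it satisfies the lifting property
along conilpotent extensions of finite-dimensional counital coalgebras. -/
def IsSmoothCoalgebra (k B : Type) [Field k]
    [AddCommGroup B] [Module k B] [Coalgebra k B] : Prop :=
  ∀ (C₁ C₂ : Type) [AddCommGroup C₁] [Module k C₁] [Coalgebra k C₁]
    [AddCommGroup C₂] [Module k C₂] [Coalgebra k C₂],
    FiniteDimensional k C₁ → FiniteDimensional k C₂ →
    ∀ f : C₁ →ₗc[k] C₂, IsConilpotentExtension f →
      ∀ g : C₁ →ₗc[k] B, ∃ h : C₂ →ₗc[k] B, h.comp f = g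

open TensorProduct Coalgebra

section Linear

variable {k V W : Type*} [Field k] [AddCommGroup V] [Module k V] [AddCommGroup W] [Module k W]

/-- Contractions of the left factor against linear forms separate tensors. -/
lemma tensor_ext_left {s t : V ⊗[k] W}
    (h : ∀ φ : V →ₗ[k] k, TensorProduct.lid k W (φ.rTensor W s) =
      TensorProduct.lid k W (φ.rTensor W t)) : s = t := by
  classical
  let b := Module.Basis.ofVectorSpace k V
  apply (TensorProduct.equivFinsuppOfBasisLeft (N := W) b).injective
  ext i
  simpa [TensorProduct.equivFinsuppOfBasisLeft_apply] using h (b.coord i)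

/-- Contractions of the right factor against linear forms separate tensors. -/
lemma tensor_ext_right {s t : V ⊗[k] W}
    (h : ∀ φ : W →ₗ[k] k, TensorProduct.rid k V (φ.lTensor V s) =
      TensorProduct.rid k V (φ.lTensor V t)) : s = t := by
  classical
  let b := Module.Basis.ofVectorSpace k W
  apply (TensorProduct.equivFinsuppOfBasisRight (M := V) b).injective
  ext i
  simpa [TensorProduct.equivFinsuppOfBasisRight_apply] using h (b.coord i)

/-- A projection onto `F` that preserves `E`. -/
lemma exists_projection_preserving (E F : Submodule k V) :
    ∃ π : V →ₗ[k] F, (∀ x : F, π x = x) ∧ ∀ x ∈ E, (π x : V) ∈ F ⊓ E := by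
  obtain ⟨r, hr⟩ := LinearMap.exists_leftInverse_of_injective
    (Submodule.inclusion (inf_le_right : F ⊓ E ≤ E))
    (LinearMap.ker_eq_bot.2 (Submodule.inclusion_injective _))
  let p : V →ₗ.[k] F := ⟨F, LinearMap.id⟩
  let q : V →ₗ.[k] F := ⟨E, Submodule.inclusion inf_le_left ∘ₗ r⟩
  have hpq : ∀ (x : p.domain) (y : q.domain), (x : V) = y → p x = q y := by
    rintro ⟨x, hx⟩ ⟨y, hy⟩ (rfl : x = y)
    have := LinearMap.congr_fun hr ⟨x, hx, hy⟩
    apply Subtype.ext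
    exact (congrArg Subtype.val this).symm
  obtain ⟨π, hπ⟩ := LinearMap.exists_extend (p.sup q hpq).toFun
  have hval : ∀ x : (p.sup q hpq).domain, π x = (p.sup q hpq) x :=
    fun x => LinearMap.congr_fun hπ x
  refine ⟨π, fun x => ?_, fun x hx => ?_⟩
  · have hle := LinearPMap.left_le_sup p q hpq
    have h1 := hval ⟨x, hle.1 x.2⟩
    rw [← hle.2 (x := x) (y := ⟨x, hle.1 x.2⟩) rfl] at h1
    exact h1
  · have hle := LinearPMap.right_le_sup p q hpq
    have h1 := hval ⟨x, hle.1 hx⟩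
    rw [← hle.2 (x := ⟨x, hx⟩) (y := ⟨x, hle.1 hx⟩) rfl] at h1
    have h2 : (π x : V) = r ⟨x, hx⟩ := congrArg Subtype.val h1
    rw [h2]
    exact (r ⟨x, hx⟩).2

lemma map_subtype_injective (E F : Submodule k V) :
    Function.Injective (TensorProduct.map E.subtype F.subtype) :=
  TensorProduct.map_injective_of_flat_flat _ _ E.injective_subtype F.injective_subtype

end Linear

section Subcoalgebra

variable {k D : Type*} [Field k] [AddCommGroup D] [Module k D] [Coalgebra k D]

/-- A subspace `E` with `Δ(E) ⊆ E ⊗ E` inherits a coalgebra structure. -/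
lemma exists_coalgebra_submodule (E : Submodule k D)
    (hE : ∀ x ∈ E, comul (R := k) x ∈ LinearMap.range (TensorProduct.map E.subtype E.subtype)) :
    ∃ inst : Coalgebra k E,
      (∀ x : E, TensorProduct.map E.subtype E.subtype (inst.comul x) = comul (R := k) (x : D)) ∧
      ∀ x : E, inst.counit x = counit (R := k) (x : D) := by
  let j := TensorProduct.map E.subtype E.subtype
  have hj : Function.Injective j := map_subtype_injective E E
  let Δ : E →ₗ[k] E ⊗[k] E := (LinearEquiv.ofInjective j hj).symm.toLinearMap ∘ₗ
    LinearMap.codRestrict (LinearMap.range j) (comul ∘ₗ E.subtype) (fun x => hE x x.2)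
  let ε : E →ₗ[k] k := counit ∘ₗ E.subtype
  have hΔ (x : E) : j (Δ x) = comul (R := k) (x : D) := by
    have := congrArg Subtype.val ((LinearEquiv.ofInjective j hj).apply_symm_apply
      (LinearMap.codRestrict (LinearMap.range j) (comul ∘ₗ E.subtype) (fun x => hE x x.2) x))
    exact this
  refine ⟨{ comul := Δ, counit := ε, coassoc := ?_, rTensor_counit_comp_comul := ?_,
            lTensor_counit_comp_comul := ?_ }, hΔ, fun x => rfl⟩
  · have hjj : Function.Injective (TensorProduct.map E.subtype j) :=
      TensorProduct.map_injective_of_flat_flat _ _ E.injective_subtype hj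
    ext1 x
    apply hjj
    have h1 (t : E ⊗[k] E) : TensorProduct.map E.subtype j
        (TensorProduct.assoc k E E E (Δ.rTensor E t)) =
        TensorProduct.assoc k D D D ((comul (R := k)).rTensor D (j t)) := by
      induction t with
      | zero => simp
      | add s t hs ht => simp only [map_add, hs, ht]
      | tmul a b =>
        simp only [j, LinearMap.rTensor_tmul, TensorProduct.map_tmul, Submodule.subtype_apply]
        rw [← hΔ]
        generalize Δ a = u
        induction u with
        | zero => simp
        | add s t hs ht => simp only [map_add, TensorProduct.add_tmul, hs, ht]
        | tmul c d => simp [j]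
    have h2 (t : E ⊗[k] E) : TensorProduct.map E.subtype j (Δ.lTensor E t) =
        (comul (R := k)).lTensor D (j t) := by
      induction t with
      | zero => simp
      | add s t hs ht => simp only [map_add, hs, ht]
      | tmul a b => simp [hΔ, show j (a ⊗ₜ b) = (a : D) ⊗ₜ (b : D) from rfl]
    simp only [LinearMap.comp_apply, LinearEquiv.coe_coe]
    rw [h1, h2, hΔ, Coalgebra.coassoc_apply]
  · ext1 x
    apply (TensorProduct.lid k E).injective
    apply E.injective_subtype
    have h (t : E ⊗[k] E) : ((TensorProduct.lid k E (ε.rTensor E t) : E) : D) =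
        TensorProduct.lid k D ((counit (R := k)).rTensor D (j t)) := by
      induction t with
      | zero => simp
      | add s t hs ht => simp only [map_add, Submodule.coe_add, hs, ht]
      | tmul a b => simp [j, ε]
    simp [h, hΔ]
  · ext1 x
    apply (TensorProduct.rid k E).injective
    apply E.injective_subtype
    have h (t : E ⊗[k] E) : ((TensorProduct.rid k E (ε.lTensor E t) : E) : D) =
        TensorProduct.rid k D ((counit (R := k)).lTensor D (j t)) := by
      induction t with
      | zero => simp
      | add s t hs ht => simp only [map_add, Submodule.coe_add, hs, ht]
      | tmul a b => simp [j, ε]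
    simp [h, hΔ]

/-- The operator `x ↦ ∑ φ(x₁) x₂`. -/
noncomputable def comulContractLeft (φ : D →ₗ[k] k) : D →ₗ[k] D :=
  (TensorProduct.lid k D).toLinearMap ∘ₗ φ.rTensor D ∘ₗ comul

/-- The operator `x ↦ ∑ φ(x₂) x₁`. -/
noncomputable def comulContractRight (φ : D →ₗ[k] k) : D →ₗ[k] D :=
  (TensorProduct.rid k D).toLinearMap ∘ₗ φ.lTensor D ∘ₗ comul

lemma comulContractLeft_apply (φ : D →ₗ[k] k) (x : D) :
    comulContractLeft φ x = TensorProduct.lid k D (φ.rTensor D (comul x)) := rfl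

lemma comulContractRight_apply (φ : D →ₗ[k] k) (x : D) :
    comulContractRight φ x = TensorProduct.rid k D (φ.lTensor D (comul x)) := rfl

lemma comulContractLeft_contractLeft (φ ψ : D →ₗ[k] k) (x : D) :
    comulContractLeft φ (comulContractLeft ψ x) =
      comulContractLeft (LinearMap.mul' k k ∘ₗ TensorProduct.map ψ φ ∘ₗ comul) x := by
  have h1 (t : D ⊗[k] D) : comulContractLeft φ (TensorProduct.lid k D (ψ.rTensor D t)) =
      TensorProduct.lid k D (TensorProduct.map ψ
        ((TensorProduct.lid k D).toLinearMap ∘ₗ φ.rTensor D) ((comul (R := k)).lTensor D t)) := by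
    induction t with
    | zero => simp
    | add s t hs ht => simp only [map_add, hs, ht]
    | tmul a b => simp [comulContractLeft]
  rw [comulContractLeft_apply ψ, h1, ← Coalgebra.coassoc_apply, comulContractLeft_apply]
  generalize comul (R := k) x = t
  induction t with
  | zero => simp
  | add s t hs ht => simp only [map_add, hs, ht]
  | tmul a b =>
    simp only [LinearMap.rTensor_tmul, LinearMap.comp_apply]
    generalize comul (R := k) a = u
    induction u with
    | zero => simp
    | add s t hs ht => simp only [map_add, TensorProduct.add_tmul, hs, ht]
    | tmul c d => simp [smul_smul, mul_comm]

lemma comulContractRight_contractRight (φ ψ : D →ₗ[k] k) (x : D) :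
    comulContractRight φ (comulContractRight ψ x) =
      comulContractRight (LinearMap.mul' k k ∘ₗ TensorProduct.map φ ψ ∘ₗ comul) x := by
  have h1 : comulContractRight (LinearMap.mul' k k ∘ₗ TensorProduct.map φ ψ ∘ₗ comul) x =
      TensorProduct.rid k D (TensorProduct.map LinearMap.id
        (LinearMap.mul' k k ∘ₗ TensorProduct.map φ ψ)
          ((comul (R := k)).lTensor D (comul (R := k) x))) := by
    rw [comulContractRight_apply]
    generalize comul (R := k) x = t
    induction t with
    | zero => simp
    | add s t hs ht => simp only [map_add, hs, ht]
    | tmul a b => simp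
  rw [h1, ← Coalgebra.coassoc_apply, comulContractRight_apply ψ]
  generalize comul (R := k) x = t
  induction t with
  | zero => simp
  | add s t hs ht => simp only [map_add, hs, ht]
  | tmul a b =>
    simp only [LinearMap.rTensor_tmul, LinearMap.lTensor_tmul, TensorProduct.rid_tmul, map_smul,
      comulContractRight_apply]
    generalize comul (R := k) a = u
    induction u with
    | zero => simp
    | add s t hs ht => simp only [map_add, smul_add, TensorProduct.add_tmul, hs, ht]
    | tmul c d => simp [smul_smul, mul_comm]

lemma comulContractLeft_contractRight (φ ψ : D →ₗ[k] k) (x : D) :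
    comulContractLeft φ (comulContractRight ψ x) = comulContractRight ψ (comulContractLeft φ x) := by
  have h1 (t : D ⊗[k] D) : comulContractRight ψ (TensorProduct.lid k D (φ.rTensor D t)) =
      TensorProduct.lid k D (TensorProduct.map φ
        ((TensorProduct.rid k D).toLinearMap ∘ₗ ψ.lTensor D) ((comul (R := k)).lTensor D t)) := by
    induction t with
    | zero => simp
    | add s t hs ht => simp only [map_add, hs, ht]
    | tmul a b => simp [comulContractRight]
  rw [comulContractLeft_apply φ x, h1, ← Coalgebra.coassoc_apply, comulContractRight_apply ψ x]
  generalize comul (R := k) x = t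
  induction t with
  | zero => simp
  | add s t hs ht => simp only [map_add, hs, ht]
  | tmul a b =>
    simp only [LinearMap.rTensor_tmul, LinearMap.lTensor_tmul, TensorProduct.rid_tmul, map_smul,
      comulContractLeft_apply]
    generalize comul (R := k) a = u
    induction u with
    | zero => simp
    | add s t hs ht => simp only [map_add, smul_add, TensorProduct.add_tmul, hs, ht]
    | tmul c d => simp [smul_smul, mul_comm]

lemma comul_mem_of_contract_mem (F : Submodule k D) {x : D}
    (hl : ∀ φ : D →ₗ[k] k, comulContractLeft φ x ∈ F) (hr : ∀ φ : D →ₗ[k] k, comulContractRight φ x ∈ F) :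
    comul (R := k) x ∈ LinearMap.range (TensorProduct.map F.subtype F.subtype) := by
  obtain ⟨π, hπ, -⟩ := exists_projection_preserving F F
  have hπ' : ∀ y ∈ F, F.subtype (π y) = y := fun y hy => congrArg Subtype.val (hπ ⟨y, hy⟩)
  have h1 : (F.subtype ∘ₗ π).lTensor D (comul (R := k) x) = comul (R := k) x := by
    refine tensor_ext_left fun φ => ?_
    have h (t : D ⊗[k] D) : TensorProduct.lid k D (φ.rTensor D ((F.subtype ∘ₗ π).lTensor D t)) =
        F.subtype (π (TensorProduct.lid k D (φ.rTensor D t))) := by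
      induction t with
      | zero => simp
      | add s t hs ht => simp only [map_add, hs, ht]
      | tmul a b => simp
    rw [h]
    exact hπ' _ (hl φ)
  have h2 : (F.subtype ∘ₗ π).rTensor D (comul (R := k) x) = comul (R := k) x := by
    refine tensor_ext_right fun φ => ?_
    have h (t : D ⊗[k] D) : TensorProduct.rid k D (φ.lTensor D ((F.subtype ∘ₗ π).rTensor D t)) =
        F.subtype (π (TensorProduct.rid k D (φ.lTensor D t))) := by
      induction t with
      | zero => simp
      | add s t hs ht => simp only [map_add, hs, ht]
      | tmul a b => simp
    rw [h]
    exact hπ' _ (hr φ)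
  refine ⟨TensorProduct.map π π (comul x), ?_⟩
  conv_rhs => rw [← h1, ← h2]
  generalize comul (R := k) x = t
  induction t with
  | zero => simp
  | add s t hs ht => simp only [map_add, hs, ht]
  | tmul a b => simp

lemma comulContractRight_mem_of_comul_eq {ι : Type*} (s : Finset ι) (a b : ι → D) (x : D)
    (h : comul (R := k) x = ∑ i ∈ s, a i ⊗ₜ b i) (φ : D →ₗ[k] k) :
    comulContractRight φ x ∈ Submodule.span k (a '' s) := by
  rw [comulContractRight_apply, h]
  simp only [map_sum, LinearMap.lTensor_tmul, TensorProduct.rid_tmul]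
  exact Submodule.sum_mem _ fun i hi =>
    Submodule.smul_mem _ _ (Submodule.subset_span ⟨i, hi, rfl⟩)

/-- The fundamental theorem of coalgebras. -/
theorem exists_finiteDimensional_subcoalgebra (x : D) :
    ∃ F : Submodule k D, FiniteDimensional k F ∧ x ∈ F ∧
      ∀ y ∈ F, comul (R := k) y ∈ LinearMap.range (TensorProduct.map F.subtype F.subtype) := by
  let F : Submodule k D := Submodule.span k
    {y | ∃ φ ψ : D →ₗ[k] k, y = comulContractRight ψ (comulContractLeft φ x)}
  have hF (φ ψ : D →ₗ[k] k) : comulContractRight ψ (comulContractLeft φ x) ∈ F :=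
    Submodule.subset_span ⟨φ, ψ, rfl⟩
  refine ⟨F, ?_, ?_, fun y hy => comul_mem_of_contract_mem F (fun φ => ?_) fun φ => ?_⟩
  · let r := Coalgebra.Repr.arbitrary k x
    let r' := fun i => Coalgebra.Repr.arbitrary k (r.right i)
    let S := fun i => Submodule.span k ((r' i).left '' (r' i).index)
    have hS (i : D × D) : FiniteDimensional k (S i) :=
      FiniteDimensional.span_of_finite k ((r' i).index.finite_toSet.image _)
    have := Submodule.finiteDimensional_finset_sup r.index S
    refine Submodule.finiteDimensional_of_le (S₂ := r.index.sup S) (Submodule.span_le.2 ?_)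
    rintro _ ⟨φ, ψ, rfl⟩
    rw [comulContractLeft_apply, ← r.eq]
    simp only [map_sum, LinearMap.rTensor_tmul, TensorProduct.lid_tmul, map_smul]
    refine Submodule.sum_mem _ fun i hi => Submodule.smul_mem _ _ ?_
    exact Finset.le_sup (f := S) hi
      (comulContractRight_mem_of_comul_eq _ _ _ _ (r' i).eq.symm ψ)
  · simpa [comulContractLeft_apply, comulContractRight_apply] using hF counit counit
  · have : F ≤ F.comap (comulContractLeft φ) := by
      refine Submodule.span_le.2 ?_
      rintro _ ⟨φ', ψ, rfl⟩
      simp only [Submodule.comap_coe, Set.mem_preimage, SetLike.mem_coe]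
      rw [comulContractLeft_contractRight, comulContractLeft_contractLeft]
      exact hF _ _
    exact this hy
  · have : F ≤ F.comap (comulContractRight φ) := by
      refine Submodule.span_le.2 ?_
      rintro _ ⟨φ', ψ, rfl⟩
      simp only [Submodule.comap_coe, Set.mem_preimage, SetLike.mem_coe]
      rw [comulContractRight_contractRight]
      exact hF _ _
    exact this hy

end Subcoalgebra

section Lifting

variable {k D B : Type} [Field k] [AddCommGroup D] [Module k D] [Coalgebra k D]
  [AddCommGroup B] [Module k B] [Coalgebra k B]

/-- A partial linear map `p` is a partial coalgebra homomorphism if its domain is a subcoalgebra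
and `p` is compatible with comultiplication and counit. -/
def IsPartialCoalgHom (p : D →ₗ.[k] B) : Prop :=
  ∀ x : p.domain, counit (R := k) (p x) = counit (R := k) (x : D) ∧
    ∃ t : p.domain ⊗[k] p.domain,
      TensorProduct.map p.domain.subtype p.domain.subtype t = comul (R := k) (x : D) ∧
      TensorProduct.map p.toFun p.toFun t = comul (R := k) (p x)

/-- The condition of `IsPartialCoalgHom` at a single point is inherited by extensions. -/
lemma partialCoalgHom_witness_of_le {p q : D →ₗ.[k] B} (hp : IsPartialCoalgHom p) (hpq : p ≤ q)
    (x : p.domain) (y : q.domain) (hxy : (x : D) = y) :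
    counit (R := k) (q y) = counit (R := k) (y : D) ∧
    ∃ t : q.domain ⊗[k] q.domain,
      TensorProduct.map q.domain.subtype q.domain.subtype t = comul (R := k) (y : D) ∧
      TensorProduct.map q.toFun q.toFun t = comul (R := k) (q y) := by
  obtain ⟨h1, t, h2, h3⟩ := hp x
  rw [← hpq.2 hxy, ← hxy]
  refine ⟨h1, TensorProduct.map (Submodule.inclusion hpq.1) (Submodule.inclusion hpq.1) t, ?_, ?_⟩
  · rw [← h2, ← LinearMap.comp_apply, ← TensorProduct.map_comp]
    rfl
  · rw [← h3, ← LinearMap.comp_apply, ← TensorProduct.map_comp]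
    have : q.toFun ∘ₗ Submodule.inclusion hpq.1 = p.toFun :=
      LinearMap.ext fun z => (hpq.2 (x := z) (y := Submodule.inclusion hpq.1 z) rfl).symm
    rw [this]

lemma IsPartialCoalgHom.sup {p q : D →ₗ.[k] B} (hp : IsPartialCoalgHom p)
    (hq : IsPartialCoalgHom q)
    (h : ∀ (x : p.domain) (y : q.domain), (x : D) = y → p x = q y) :
    IsPartialCoalgHom (p.sup q h) := by
  have hl := LinearPMap.left_le_sup p q h
  have hr := LinearPMap.right_le_sup p q h
  intro x
  obtain ⟨y, hy, z, hz, hyz⟩ := Submodule.mem_sup.1 (show (x : D) ∈ p.domain ⊔ q.domain from x.2)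
  obtain ⟨a1, t, a2, a3⟩ := partialCoalgHom_witness_of_le hp hl ⟨y, hy⟩ ⟨y, hl.1 hy⟩ rfl
  obtain ⟨b1, u, b2, b3⟩ := partialCoalgHom_witness_of_le hq hr ⟨z, hz⟩ ⟨z, hr.1 hz⟩ rfl
  obtain rfl : x = ⟨y, hl.1 hy⟩ + ⟨z, hr.1 hz⟩ := Subtype.ext hyz.symm
  refine ⟨?_, t + u, ?_, ?_⟩
  · simp only [LinearPMap.map_add, map_add, a1, b1, Submodule.coe_add]
  · simp only [map_add, a2, b2, Submodule.coe_add]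
  · simp only [LinearPMap.map_add, map_add, a3, b3]

/-- Every partial coalgebra homomorphism extends to a maximal one. -/
lemma IsPartialCoalgHom.exists_maximal {p : D →ₗ.[k] B} (hp : IsPartialCoalgHom p) :
    ∃ q, p ≤ q ∧ Maximal IsPartialCoalgHom q := by
  refine zorn_le_nonempty₀ {q : D →ₗ.[k] B | IsPartialCoalgHom q} (fun c hc hchain y hy => ?_) p hp
  have hdir : DirectedOn (· ≤ ·) c := hchain.directedOn
  refine ⟨LinearPMap.sSup c hdir, fun x => ?_, fun z hz => LinearPMap.le_sSup hdir hz⟩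
  obtain ⟨q, hq, hxq⟩ := (LinearPMap.mem_domain_sSup_iff ⟨y, hy⟩ hdir).1 x.2
  exact partialCoalgHom_witness_of_le (hc hq) (LinearPMap.le_sSup hdir hq) ⟨x, hxq⟩ x rfl

/-- A coalgebra homomorphism on a subcoalgebra is a partial coalgebra homomorphism. -/
lemma isPartialCoalgHom_mk (F : Submodule k D) [Coalgebra k F]
    (hΔ : ∀ x : F, TensorProduct.map F.subtype F.subtype (comul (R := k) x) =
      comul (R := k) (x : D))
    (hε : ∀ x : F, counit (R := k) x = counit (R := k) (x : D))
    (h : F →ₗc[k] B) : IsPartialCoalgHom ⟨F, h.toLinearMap⟩ := fun x =>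
  ⟨(CoalgHomClass.counit_comp_apply h x).trans (hε x), comul x, hΔ x,
    CoalgHomClass.map_comp_comul_apply h x⟩

/-- A partial coalgebra homomorphism into a smooth coalgebra, whose domain `E` satisfies
`Δ(D) ⊆ E ⊗ D + D ⊗ E`, extends to any finite-dimensional subcoalgebra. -/
lemma IsPartialCoalgHom.exists_extension_finiteDimensional (hB : IsSmoothCoalgebra k B)
    {p : D →ₗ.[k] B} (hp : IsPartialCoalgHom p)
    (hD : ∀ x : D, comul (R := k) x ∈
      LinearMap.range (TensorProduct.map p.domain.subtype (LinearMap.id : D →ₗ[k] D)) ⊔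
      LinearMap.range (TensorProduct.map (LinearMap.id : D →ₗ[k] D) p.domain.subtype))
    (F : Submodule k D) [FiniteDimensional k F]
    (hF : ∀ x ∈ F, comul (R := k) x ∈ LinearMap.range (TensorProduct.map F.subtype F.subtype)) :
    ∃ q, p ≤ q ∧ IsPartialCoalgHom q ∧ F ≤ q.domain := by
  let E := p.domain
  let G := F ⊓ E
  obtain ⟨π, hπ, hπE⟩ := exists_projection_preserving E F
  have hπ' : π ∘ₗ F.subtype = LinearMap.id := LinearMap.ext hπ
  let i : G →ₗ[k] F := Submodule.inclusion inf_le_left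
  let ρ : E →ₗ[k] G := LinearMap.codRestrict G (F.subtype ∘ₗ π ∘ₗ E.subtype) fun x => hπE x x.2
  have hρ : G.subtype ∘ₗ ρ = F.subtype ∘ₗ π ∘ₗ E.subtype := rfl
  have hππ (x : D) (hx : x ∈ F) :
      TensorProduct.map (F.subtype ∘ₗ π) (F.subtype ∘ₗ π) (comul (R := k) x) = comul x := by
    obtain ⟨u, hu⟩ := hF x hx
    rw [← hu, ← LinearMap.comp_apply, ← TensorProduct.map_comp, LinearMap.comp_assoc, hπ']
    rfl
  have hG (x : D) (hx : x ∈ G) : comul (R := k) x ∈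
      LinearMap.range (TensorProduct.map G.subtype G.subtype) := by
    obtain ⟨-, t, ht, -⟩ := hp ⟨x, hx.2⟩
    refine ⟨TensorProduct.map ρ ρ t, ?_⟩
    rw [← hππ x hx.1, ← ht, ← LinearMap.comp_apply, ← LinearMap.comp_apply,
      ← TensorProduct.map_comp, ← TensorProduct.map_comp, hρ]
    rfl
  obtain ⟨instF, hΔF, hεF⟩ := exists_coalgebra_submodule F hF
  obtain ⟨instG, hΔG, hεG⟩ := exists_coalgebra_submodule G hG
  let f : G →ₗc[k] F :=
    { i with
      counit_comp := LinearMap.ext fun x => (hεF _).trans (hεG x).symm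
      map_comp_comul := LinearMap.ext fun x => by
        apply map_subtype_injective F F
        rw [LinearMap.comp_apply, LinearMap.comp_apply, hΔF, ← LinearMap.comp_apply,
          ← TensorProduct.map_comp]
        exact hΔG x }
  have hf : IsMinimalConilpotentExtension f := by
    refine ⟨Submodule.inclusion_injective (inf_le_left : G ≤ F), fun x => ?_⟩
    obtain ⟨_, ⟨s, rfl⟩, _, ⟨t, rfl⟩, hst⟩ := Submodule.mem_sup.1 (hD x)
    have hx : comul (R := k) x = TensorProduct.map π π (comul (R := k) (x : D)) := by
      rw [← hΔF, ← LinearMap.comp_apply, ← TensorProduct.map_comp, hπ', TensorProduct.map_id]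
      rfl
    rw [hx, ← hst, map_add]
    refine Submodule.add_mem_sup ⟨TensorProduct.map ρ π s, ?_⟩ ⟨TensorProduct.map π ρ t, ?_⟩
    all_goals
      rw [← LinearMap.comp_apply, ← LinearMap.comp_apply, ← TensorProduct.map_comp,
        ← TensorProduct.map_comp]
      rfl
  let j : G →ₗ[k] E := Submodule.inclusion inf_le_right
  let g : G →ₗc[k] B :=
    { p.toFun ∘ₗ j with
      counit_comp := LinearMap.ext fun x => (hp (j x)).1.trans (hεG x).symm
      map_comp_comul := LinearMap.ext fun x => by
        obtain ⟨-, t, h1, h2⟩ := hp (j x)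
        have : t = TensorProduct.map j j (comul x) := by
          apply map_subtype_injective E E
          rw [h1, ← LinearMap.comp_apply, ← TensorProduct.map_comp]
          exact (hΔG x).symm
        rw [this, ← LinearMap.comp_apply, ← TensorProduct.map_comp] at h2
        exact h2 }
  have : FiniteDimensional k G := Submodule.finiteDimensional_of_le (S₂ := F) inf_le_left
  obtain ⟨h, hh⟩ := hB G F inferInstance inferInstance f ⟨0, hf⟩ g
  let q : D →ₗ.[k] B := ⟨F, h.toLinearMap⟩
  have hq : IsPartialCoalgHom q := isPartialCoalgHom_mk F hΔF hεF h
  have hpq : ∀ (x : p.domain) (y : q.domain), (x : D) = y → p x = q y := by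
    rintro ⟨x, hx⟩ ⟨y, hy⟩ (rfl : x = y)
    exact (congrArg (fun u => u ⟨x, hy, hx⟩) hh).symm
  exact ⟨p.sup q hpq, LinearPMap.left_le_sup p q hpq, hp.sup hq hpq,
    (LinearPMap.right_le_sup p q hpq).1⟩

/-- Smooth coalgebras have the lifting property along arbitrary minimal conilpotent extensions,
without finiteness assumptions. -/
theorem IsSmoothCoalgebra.exists_lift (hB : IsSmoothCoalgebra k B)
    {C : Type} [AddCommGroup C] [Module k C] [Coalgebra k C] (f : C →ₗc[k] D)
    (hf : IsMinimalConilpotentExtension f) (g : C →ₗc[k] B) : ∃ h : D →ₗc[k] B, h.comp f = g := by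
  let e : C ≃ₗ[k] LinearMap.range f.toLinearMap := LinearEquiv.ofInjective f.toLinearMap hf.1
  let p : D →ₗ.[k] B := ⟨LinearMap.range f.toLinearMap, g.toLinearMap ∘ₗ e.symm.toLinearMap⟩
  have hpe (y : C) : p (e y) = g y := congrArg g (e.symm_apply_apply y)
  have hp : IsPartialCoalgHom p := by
    intro x
    obtain ⟨y, rfl⟩ := e.surjective x
    rw [hpe]
    refine ⟨(CoalgHomClass.counit_comp_apply g y).trans (CoalgHomClass.counit_comp_apply f y).symm,
      TensorProduct.map e.toLinearMap e.toLinearMap (comul y), ?_, ?_⟩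
    · rw [← LinearMap.comp_apply, ← TensorProduct.map_comp]
      exact CoalgHomClass.map_comp_comul_apply f y
    · rw [← LinearMap.comp_apply, ← TensorProduct.map_comp,
        show p.toFun ∘ₗ e.toLinearMap = g.toLinearMap from LinearMap.ext hpe]
      exact CoalgHomClass.map_comp_comul_apply g y
  obtain ⟨q, hpq, hq⟩ := hp.exists_maximal
  let f' : C →ₗ[k] q.domain := Submodule.inclusion hpq.1 ∘ₗ e.toLinearMap
  have hf' : f.toLinearMap = q.domain.subtype ∘ₗ f' := rfl
  have hD (x : D) : comul (R := k) x ∈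
      LinearMap.range (TensorProduct.map q.domain.subtype (LinearMap.id : D →ₗ[k] D)) ⊔
      LinearMap.range (TensorProduct.map (LinearMap.id : D →ₗ[k] D) q.domain.subtype) := by
    refine SetLike.le_def.1 (sup_le_sup ?_ ?_) (hf.2 x)
    · rintro _ ⟨s, rfl⟩
      refine ⟨TensorProduct.map f' LinearMap.id s, ?_⟩
      rw [← LinearMap.comp_apply, ← TensorProduct.map_comp]
      rfl
    · rintro _ ⟨s, rfl⟩
      refine ⟨TensorProduct.map LinearMap.id f' s, ?_⟩
      rw [← LinearMap.comp_apply, ← TensorProduct.map_comp]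
      rfl
  have htop (x : D) : x ∈ q.domain := by
    obtain ⟨F, _, hxF, hF⟩ := exists_finiteDimensional_subcoalgebra (k := k) x
    obtain ⟨r, hqr, hr, hFr⟩ := hq.1.exists_extension_finiteDimensional hB hD F hF
    exact (hq.2 hr hqr).1 (hFr hxF)
  let c : D →ₗ[k] q.domain := LinearMap.codRestrict q.domain LinearMap.id htop
  have hc : c ∘ₗ q.domain.subtype = LinearMap.id := rfl
  refine ⟨{ q.toFun ∘ₗ c with
            counit_comp := LinearMap.ext fun x => (hq.1 (c x)).1
            map_comp_comul := LinearMap.ext fun x => ?_ }, ?_⟩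
  · obtain ⟨-, t, h1, h2⟩ := hq.1 (c x)
    have h3 : comul (R := k) x = TensorProduct.map q.domain.subtype q.domain.subtype t := h1.symm
    rw [LinearMap.comp_apply, h3, ← LinearMap.comp_apply, ← TensorProduct.map_comp]
    exact h2
  · ext y
    exact (hpq.2 (x := e y) (y := c (f y)) rfl).symm.trans (hpe y)

end Lifting

section Tensor

variable {k C D X : Type} [Field k] [AddCommGroup C] [Module k C] [Coalgebra k C]
  [AddCommGroup D] [Module k D] [Coalgebra k D] [AddCommGroup X] [Module k X] [Coalgebra k X]

/-- Tensoring with a coalgebra preserves minimal conilpotent extensions. -/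
lemma IsMinimalConilpotentExtension.tensor {f : C →ₗc[k] D} (hf : IsMinimalConilpotentExtension f) :
    IsMinimalConilpotentExtension (Coalgebra.TensorProduct.map f (CoalgHom.id k X)) := by
  let F : C ⊗[k] X →ₗ[k] D ⊗[k] X := TensorProduct.map f.toLinearMap LinearMap.id
  have hF : (Coalgebra.TensorProduct.map f (CoalgHom.id k X)).toLinearMap = F := rfl
  refine ⟨TensorProduct.map_injective_of_flat_flat f.toLinearMap (LinearMap.id : X →ₗ[k] X) hf.1
    Function.injective_id, fun x => ?_⟩
  rw [hF]
  induction x with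
  | zero => simp
  | add x y hx hy => rw [map_add]; exact Submodule.add_mem _ hx hy
  | tmul d x =>
    rw [TensorProduct.comul_tmul]
    obtain ⟨_, ⟨s, rfl⟩, _, ⟨t, rfl⟩, hst⟩ := Submodule.mem_sup.1 (hf.2 d)
    rw [← hst, TensorProduct.add_tmul, map_add]
    clear hst
    generalize comul (R := k) x = u
    refine Submodule.add_mem_sup
      ⟨TensorProduct.tensorTensorTensorComm k C D X X (s ⊗ₜ u), ?_⟩
      ⟨TensorProduct.tensorTensorTensorComm k D C X X (t ⊗ₜ u), ?_⟩
    · induction s with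
      | zero => simp
      | add s s' hs hs' => simp only [map_add, TensorProduct.add_tmul, hs, hs']
      | tmul a b =>
        induction u with
        | zero => simp
        | add u u' hu hu' => simp only [map_add, TensorProduct.tmul_add, hu, hu']
        | tmul c d => rfl
    · induction t with
      | zero => simp
      | add s s' hs hs' => simp only [map_add, TensorProduct.add_tmul, hs, hs']
      | tmul a b =>
        induction u with
        | zero => simp
        | add u u' hu hu' => simp only [map_add, TensorProduct.tmul_add, hu, hu']
        | tmul c d => rfl

end Tensor

/-- Lifting into a smooth coalgebra along `f ⊗ id` for a conilpotent chain `f`. -/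
lemma IsConilpotentChain.exists_lift_tensor {k B X : Type} [Field k]
    [AddCommGroup B] [Module k B] [Coalgebra k B] [AddCommGroup X] [Module k X] [Coalgebra k X]
    (hB : IsSmoothCoalgebra k B) (n : ℕ) :
    ∀ (C D : Type) [AddCommGroup C] [Module k C] [Coalgebra k C]
      [AddCommGroup D] [Module k D] [Coalgebra k D] (f : C →ₗc[k] D),
      IsConilpotentChain k n C D f → ∀ g : (C ⊗[k] X) →ₗc[k] B,
        ∃ h : (D ⊗[k] X) →ₗc[k] B,
          h.comp (Coalgebra.TensorProduct.map f (CoalgHom.id k X)) = g := by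
  induction n with
  | zero => exact fun C D _ _ _ _ _ _ f hf g => hB.exists_lift _ hf.tensor g
  | succ n ih =>
    rintro C D _ _ _ _ _ _ f ⟨E, u, v, hu, hv, rfl⟩ g
    obtain ⟨h, rfl⟩ := ih C E.carrier u hu g
    obtain ⟨h', rfl⟩ := hB.exists_lift _ (hv.tensor (X := X)) h
    refine ⟨h', ?_⟩
    apply CoalgHom.ext
    intro x
    induction x with
    | zero => simp
    | add x y hx hy => simp only [map_add, hx, hy]
    | tmul c x => rfl

/-- **The inner Hom into a smooth coalgebra is smooth**: if `B_Y` is a smooth counital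
coalgebra and `H` is an inner Hom from `B_X` to `B_Y`, i.e. a counital coalgebra
equipped with bijections `Hom_Coalg(C ⊗ B_X, B_Y) ≅ Hom_Coalg(C, H)` natural in the
counital coalgebra `C`, then `H` is smooth. -/
theorem inner_hom_smooth (k BX BY H : Type) [Field k]
    [AddCommGroup BX] [Module k BX] [Coalgebra k BX]
    [AddCommGroup BY] [Module k BY] [Coalgebra k BY]
    [AddCommGroup H] [Module k H] [Coalgebra k H]
    (hBY : IsSmoothCoalgebra k BY)
    (Φ : ∀ C : CoalgCarrier k, ((C.carrier ⊗[k] BX) →ₗc[k] BY) ≃ (C.carrier →ₗc[k] H))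
    (hΦ : ∀ (C C' : CoalgCarrier k) (u : C'.carrier →ₗc[k] C.carrier)
      (ψ : (C.carrier ⊗[k] BX) →ₗc[k] BY),
      Φ C' (ψ.comp (Coalgebra.TensorProduct.map u (CoalgHom.id k BX))) =
        (Φ C ψ).comp u) :
    IsSmoothCoalgebra k H := by
  intro C₁ C₂ _ _ _ _ _ _ _ _ f ⟨n, hf⟩ g
  obtain ⟨ψ, hψ⟩ := IsConilpotentChain.exists_lift_tensor hBY n C₁ C₂ f hf ((Φ ⟨C₁⟩).symm g)
  exact ⟨Φ ⟨C₂⟩ ψ, by rw [← hΦ ⟨C₂⟩ ⟨C₁⟩ f ψ, hψ, Equiv.apply_symm_apply]⟩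
end

section
/- Let f : B_X → B_Y be an injective homomorphism of counital coalgebras over a field k, and let B_f ⊆ B_Y be the completion of B_Y along f. Then B_f is a subcoalgebra of B_Y containing f(B_X): B_f is a k-subspace, f(B_X) ⊆ B_f, and Δ(B_f) is contained in the image of B_f ⊗ B_f in B_Y ⊗ B_Y. -/
open scoped TensorProduct

section
variable {k C D : Type} [Field k]
  [AddCommGroup C] [Module k C] [Coalgebra k C]
  [AddCommGroup D] [Module k D] [Coalgebra k D]

/-- The quotient of `D` by the image of a coalgebra homomorphism `f : C → D`. -/
abbrev CoalgQuot (f : C →ₗc[k] D) : Type := D ⧸ LinearMap.range f.toLinearMap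

/-- The comultiplication induced by `Δ_D` on the quotient `D ⧸ f(C)`
(well defined since `Δ ∘ f = (f ⊗ f) ∘ Δ`). -/
noncomputable def quotComul (f : C →ₗc[k] D) :
    CoalgQuot f →ₗ[k] CoalgQuot f ⊗[k] CoalgQuot f :=
  Submodule.liftQ _
    ((TensorProduct.map (LinearMap.range f.toLinearMap).mkQ
        (LinearMap.range f.toLinearMap).mkQ) ∘ₗ Coalgebra.comul)
    (by
      rintro x ⟨c, rfl⟩
      have h1 : Coalgebra.comul (R := k) (f.toLinearMap c) =
          TensorProduct.map f.toLinearMap f.toLinearMap (Coalgebra.comul c) :=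
        (CoalgHomClass.map_comp_comul_apply f c).symm
      have h2 : (LinearMap.range f.toLinearMap).mkQ ∘ₗ f.toLinearMap = 0 := by
        ext y
        exact (Submodule.Quotient.mk_eq_zero _).2 ⟨y, rfl⟩
      have h3 : (TensorProduct.map (LinearMap.range f.toLinearMap).mkQ
            (LinearMap.range f.toLinearMap).mkQ).comp
          (TensorProduct.map f.toLinearMap f.toLinearMap) = 0 := by
        rw [← TensorProduct.map_comp, h2, TensorProduct.map_zero_left]
      simp only [LinearMap.mem_ker, LinearMap.comp_apply, h1]
      rw [← LinearMap.comp_apply, h3]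
      simp)

/-- Right-nested tensor powers of the quotient `D ⧸ f(C)`. -/
noncomputable def quotTensorPower (f : C →ₗc[k] D) : ℕ → ModuleCat k
  | 0 => ModuleCat.of k (CoalgQuot f)
  | n + 1 => ModuleCat.of k (CoalgQuot f ⊗[k] quotTensorPower f n)

/-- Application of the induced comultiplication to the first tensor factor,
`Δ̄ ⊗ id^{⊗ n}`. -/
noncomputable def quotComulFirst (f : C →ₗc[k] D) :
    (n : ℕ) → (quotTensorPower f n →ₗ[k] quotTensorPower f (n + 1))
  | 0 => quotComul f
  | n + 1 =>
      (TensorProduct.assoc k (CoalgQuot f) (CoalgQuot f) (quotTensorPower f n)).toLinearMap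
        ∘ₗ (TensorProduct.map (quotComul f) LinearMap.id)

/-- The iterated comultiplication `Δ̄⁽ⁿ⁺¹⁾ : D/f(C) → (D/f(C))^{⊗ (n+1)}` of the induced
comultiplication on the quotient, so `quotIterComul f 0 = Δ̄⁽¹⁾ = id` and
`quotIterComul f n = Δ̄⁽ⁿ⁺¹⁾ = (Δ̄ ⊗ id^{⊗(n-1)}) ∘ Δ̄⁽ⁿ⁾`. -/
noncomputable def quotIterComul (f : C →ₗc[k] D) :
    (n : ℕ) → (CoalgQuot f →ₗ[k] quotTensorPower f n)
  | 0 => LinearMap.id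
  | n + 1 => quotComulFirst f n ∘ₗ quotIterComul f n

/-- An element `d` of the quotient `D ⧸ f(C)` is conilpotent if `Δ̄⁽ⁿ⁾ d = 0` for some
`n ≥ 2`. -/
def QuotConilpotent (f : C →ₗc[k] D) (d : CoalgQuot f) : Prop :=
  ∃ n : ℕ, 1 ≤ n ∧ quotIterComul f n d = 0

/-- The completion of `D` along `f : C → D`: the set of elements of `D` whose class in
`D ⧸ f(C)` is conilpotent. -/
def completionSet (f : C →ₗc[k] D) : Set D :=
  {b : D | QuotConilpotent f ((LinearMap.range f.toLinearMap).mkQ b)}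

end

section
variable {k C D : Type} [Field k]
  [AddCommGroup C] [Module k C] [Coalgebra k C]
  [AddCommGroup D] [Module k D] [Coalgebra k D]

/-- Over a field, a tensor killed by `φ` in either factor lies in `ker φ ⊗ ker φ`. -/
theorem mem_range_map_ker_subtype {V W : Type} [AddCommGroup V] [Module k V]
    [AddCommGroup W] [Module k W] (φ : V →ₗ[k] W) (z : V ⊗[k] V)
    (hl : φ.lTensor V z = 0) (hr : φ.rTensor V z = 0) :
    z ∈ LinearMap.range (TensorProduct.map (LinearMap.ker φ).subtype
      (LinearMap.ker φ).subtype) := by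
  have hex : Function.Exact (LinearMap.ker φ).subtype φ := φ.exact_subtype_ker_map
  obtain ⟨w, rfl⟩ := (Module.Flat.lTensor_exact V hex z).1 hl
  have hw : φ.rTensor (LinearMap.ker φ) w = 0 := by
    apply Module.Flat.lTensor_preserves_injective_linearMap (M := W)
      (LinearMap.ker φ).subtype (Submodule.subtype_injective _)
    rw [map_zero, ← hr]
    simp only [← LinearMap.comp_apply, LinearMap.lTensor_comp_rTensor,
      LinearMap.rTensor_comp_lTensor]
  obtain ⟨u, rfl⟩ := (Module.Flat.rTensor_exact (LinearMap.ker φ) hex w).1 hw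
  refine ⟨u, ?_⟩
  rw [← LinearMap.comp_apply, LinearMap.lTensor_comp_rTensor]

/-- Coassociativity followed by a tensor product of three linear maps. -/
theorem assoc_map_map_comul {P Q R : Type} [AddCommGroup P] [Module k P]
    [AddCommGroup Q] [Module k Q] [AddCommGroup R] [Module k R]
    (a : D →ₗ[k] P) (b : D →ₗ[k] Q) (c : D →ₗ[k] R) :
    (TensorProduct.assoc k P Q R).toLinearMap ∘ₗ
        TensorProduct.map (TensorProduct.map a b ∘ₗ Coalgebra.comul) c ∘ₗ Coalgebra.comul =
      TensorProduct.map a (TensorProduct.map b c ∘ₗ Coalgebra.comul) ∘ₗ Coalgebra.comul := by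
  have h1 : TensorProduct.map (TensorProduct.map a b ∘ₗ Coalgebra.comul) c =
      TensorProduct.map (TensorProduct.map a b) c ∘ₗ
        (Coalgebra.comul (R := k) (A := D)).rTensor D := by
    rw [LinearMap.rTensor, ← TensorProduct.map_comp, LinearMap.comp_id]
  have h2 : TensorProduct.map a (TensorProduct.map b c ∘ₗ Coalgebra.comul) =
      TensorProduct.map a (TensorProduct.map b c) ∘ₗ
        (Coalgebra.comul (R := k) (A := D)).lTensor D := by
    rw [LinearMap.lTensor, ← TensorProduct.map_comp, LinearMap.comp_id]
  have h3 : (TensorProduct.assoc k P Q R).toLinearMap ∘ₗ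
      TensorProduct.map (TensorProduct.map a b) c =
      TensorProduct.map a (TensorProduct.map b c) ∘ₗ
        (TensorProduct.assoc k D D D).toLinearMap :=
    TensorProduct.ext_threefold fun _ _ _ => rfl
  rw [h1, h2, LinearMap.comp_assoc, LinearMap.comp_assoc, ← Coalgebra.coassoc,
    ← LinearMap.comp_assoc, h3, LinearMap.comp_assoc]

/-- If `δ` is compatible with `p` and `Δ`, then applying `δ` to the first factor of
`(p ⊗ ψ) ∘ Δ` amounts to applying `Δ` to the second factor. -/
theorem assoc_map_comp_map_comul {P Q T : Type} [AddCommGroup P] [Module k P]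
    [AddCommGroup Q] [Module k Q] [AddCommGroup T] [Module k T]
    {a : D →ₗ[k] P} {p : D →ₗ[k] Q} {δ : Q →ₗ[k] P ⊗[k] Q} (ψ : D →ₗ[k] T)
    (h : δ ∘ₗ p = TensorProduct.map a p ∘ₗ Coalgebra.comul) :
    ((TensorProduct.assoc k P Q T).toLinearMap ∘ₗ TensorProduct.map δ LinearMap.id) ∘ₗ
        TensorProduct.map p ψ ∘ₗ Coalgebra.comul =
      TensorProduct.map a (TensorProduct.map p ψ ∘ₗ Coalgebra.comul) ∘ₗ Coalgebra.comul := by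
  rw [← assoc_map_map_comul, ← h, LinearMap.comp_assoc,
    ← LinearMap.comp_assoc _ (TensorProduct.map p ψ),
    ← TensorProduct.map_comp, LinearMap.id_comp]

/-- A right coaction compatible with `ψ` induces one compatible with `(p ⊗ ψ) ∘ Δ`. -/
theorem rTensor_map_comul_comp_comul {Q T : Type} [AddCommGroup Q] [Module k Q]
    [AddCommGroup T] [Module k T] (p : D →ₗ[k] Q) {ψ : D →ₗ[k] T} {R : T →ₗ[k] T ⊗[k] D}
    (h : ψ.rTensor D ∘ₗ Coalgebra.comul = R ∘ₗ ψ) :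
    (TensorProduct.map p ψ ∘ₗ Coalgebra.comul).rTensor D ∘ₗ Coalgebra.comul =
      ((TensorProduct.assoc k Q T D).symm.toLinearMap ∘ₗ TensorProduct.map LinearMap.id R) ∘ₗ
        TensorProduct.map p ψ ∘ₗ Coalgebra.comul := by
  have h' := assoc_map_map_comul p ψ (LinearMap.id (R := k) (M := D))
  rw [LinearMap.rTensor] at h
  rw [h] at h'
  rw [LinearMap.comp_assoc, ← LinearMap.comp_assoc _ (TensorProduct.map p ψ),
    ← TensorProduct.map_comp, LinearMap.id_comp, ← h', ← LinearMap.comp_assoc,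
    LinearEquiv.symm_comp, LinearMap.id_comp, LinearMap.rTensor]

variable (f : C →ₗc[k] D)

/-- The image of a coalgebra homomorphism is killed by `(g ⊗ h) ∘ Δ` as soon as `g` or `h`
kills it. -/
theorem map_comul_eq_zero_of_comp_eq_zero {P Q : Type} [AddCommGroup P] [Module k P]
    [AddCommGroup Q] [Module k Q] (g : D →ₗ[k] P) (h : D →ₗ[k] Q)
    (H : g ∘ₗ f.toLinearMap = 0 ∨ h ∘ₗ f.toLinearMap = 0) :
    LinearMap.range f.toLinearMap ≤
      LinearMap.ker (TensorProduct.map g h ∘ₗ Coalgebra.comul) := by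
  rintro _ ⟨c, rfl⟩
  have hc : Coalgebra.comul (R := k) (f.toLinearMap c) =
      TensorProduct.map f.toLinearMap f.toLinearMap (Coalgebra.comul c) :=
    (CoalgHomClass.map_comp_comul_apply f c).symm
  rw [LinearMap.mem_ker, LinearMap.comp_apply, hc, ← LinearMap.comp_apply,
    ← TensorProduct.map_comp]
  rcases H with H | H <;> rw [H] <;> simp

theorem mkQ_range_comp : (LinearMap.range f.toLinearMap).mkQ ∘ₗ f.toLinearMap = 0 :=
  LinearMap.range_mkQ_comp _

/-- The left `D`-coaction on the quotient `D ⧸ f(C)`. -/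
noncomputable def quotLeftCoaction : CoalgQuot f →ₗ[k] D ⊗[k] CoalgQuot f :=
  Submodule.liftQ _
    (TensorProduct.map LinearMap.id (LinearMap.range f.toLinearMap).mkQ ∘ₗ Coalgebra.comul)
    (map_comul_eq_zero_of_comp_eq_zero f _ _ (Or.inr (mkQ_range_comp f)))

theorem quotLeftCoaction_comp_mkQ :
    quotLeftCoaction f ∘ₗ (LinearMap.range f.toLinearMap).mkQ =
      TensorProduct.map LinearMap.id (LinearMap.range f.toLinearMap).mkQ ∘ₗ Coalgebra.comul :=
  Submodule.liftQ_mkQ _ _ _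

/-- The right `D`-coaction on the quotient `D ⧸ f(C)`. -/
noncomputable def quotRightCoaction : CoalgQuot f →ₗ[k] CoalgQuot f ⊗[k] D :=
  Submodule.liftQ _
    (TensorProduct.map (LinearMap.range f.toLinearMap).mkQ LinearMap.id ∘ₗ Coalgebra.comul)
    (map_comul_eq_zero_of_comp_eq_zero f _ _ (Or.inl (mkQ_range_comp f)))

theorem quotRightCoaction_comp_mkQ :
    quotRightCoaction f ∘ₗ (LinearMap.range f.toLinearMap).mkQ =
      TensorProduct.map (LinearMap.range f.toLinearMap).mkQ LinearMap.id ∘ₗ Coalgebra.comul :=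
  Submodule.liftQ_mkQ _ _ _

theorem quotComul_comp_mkQ :
    quotComul f ∘ₗ (LinearMap.range f.toLinearMap).mkQ =
      TensorProduct.map (LinearMap.range f.toLinearMap).mkQ
        (LinearMap.range f.toLinearMap).mkQ ∘ₗ Coalgebra.comul :=
  Submodule.liftQ_mkQ _ _ _

/-- The iterated comultiplication of the quotient, precomposed with the projection. -/
noncomputable def mkQIterComul (n : ℕ) : D →ₗ[k] quotTensorPower f n :=
  quotIterComul f n ∘ₗ (LinearMap.range f.toLinearMap).mkQ

theorem mkQIterComul_succ (n : ℕ) :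
    mkQIterComul f (n + 1) =
      TensorProduct.map (LinearMap.range f.toLinearMap).mkQ (mkQIterComul f n) ∘ₗ
        Coalgebra.comul := by
  induction n with
  | zero => exact quotComul_comp_mkQ f
  | succ n ih =>
    have h : mkQIterComul f (n + 1 + 1) =
        ((TensorProduct.assoc k (CoalgQuot f) (CoalgQuot f) (quotTensorPower f n)).toLinearMap
          ∘ₗ TensorProduct.map (quotComul f) LinearMap.id) ∘ₗ mkQIterComul f (n + 1) := rfl
    rw [h, ih]
    exact assoc_map_comp_map_comul (mkQIterComul f n) (quotComul_comp_mkQ f)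

theorem exists_lTensor_mkQIterComul (n : ℕ) :
    ∃ L : quotTensorPower f n →ₗ[k] D ⊗[k] quotTensorPower f n,
      (mkQIterComul f n).lTensor D ∘ₗ Coalgebra.comul = L ∘ₗ mkQIterComul f n := by
  cases n with
  | zero => exact ⟨quotLeftCoaction f, (quotLeftCoaction_comp_mkQ f).symm⟩
  | succ n =>
    rw [mkQIterComul_succ]
    exact ⟨_, (assoc_map_comp_map_comul (mkQIterComul f n) (quotLeftCoaction_comp_mkQ f)).symm⟩

theorem exists_rTensor_mkQIterComul (n : ℕ) :
    ∃ R : quotTensorPower f n →ₗ[k] quotTensorPower f n ⊗[k] D,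
      (mkQIterComul f n).rTensor D ∘ₗ Coalgebra.comul = R ∘ₗ mkQIterComul f n := by
  induction n with
  | zero => exact ⟨quotRightCoaction f, (quotRightCoaction_comp_mkQ f).symm⟩
  | succ n ih =>
    obtain ⟨R, hR⟩ := ih
    rw [mkQIterComul_succ]
    exact ⟨_, rTensor_map_comul_comp_comul (LinearMap.range f.toLinearMap).mkQ hR⟩

/-- The kernel of the iterated comultiplication is a subcoalgebra. -/
theorem comul_mem_range_map_ker_mkQIterComul (n : ℕ) {y : D} (hy : mkQIterComul f n y = 0) :
    Coalgebra.comul (R := k) y ∈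
      LinearMap.range (TensorProduct.map (LinearMap.ker (mkQIterComul f n)).subtype
        (LinearMap.ker (mkQIterComul f n)).subtype) := by
  obtain ⟨L, hL⟩ := exists_lTensor_mkQIterComul f n
  obtain ⟨R, hR⟩ := exists_rTensor_mkQIterComul f n
  apply mem_range_map_ker_subtype
  · simpa [hy] using LinearMap.congr_fun hL y
  · simpa [hy] using LinearMap.congr_fun hR y

theorem monotone_ker_mkQIterComul :
    Monotone fun n => LinearMap.ker (mkQIterComul f n) :=
  monotone_nat_of_le_succ fun n => LinearMap.ker_le_ker_comp (mkQIterComul f n) (quotComulFirst f n)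

theorem mem_completionSet_iff {y : D} :
    y ∈ completionSet f ↔ ∃ n, mkQIterComul f n y = 0 := by
  constructor
  · rintro ⟨n, -, hn⟩
    exact ⟨n, hn⟩
  · rintro ⟨n, hn⟩
    exact ⟨n + 1, n.succ_pos, monotone_ker_mkQIterComul f n.le_succ hn⟩

end

/-- **The completion of `B_Y` along an injective coalgebra homomorphism
`f : B_X → B_Y` is a subcoalgebra of `B_Y` containing `f(B_X)`**: the set `B_f` of
elements of `B_Y` whose class in `B_Y/f(B_X)` is conilpotent is a `k`-subspace, it
contains the image of `f`, and its image under `Δ` is contained in the image of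
`B_f ⊗ B_f` in `B_Y ⊗ B_Y`. -/
theorem completion_is_subcoalgebra
    (k BX BY : Type) [Field k]
    [AddCommGroup BX] [Module k BX] [Coalgebra k BX]
    [AddCommGroup BY] [Module k BY] [Coalgebra k BY]
    (f : BX →ₗc[k] BY) (hf : Function.Injective f) :
    ∃ Bf : Submodule k BY,
      (Bf : Set BY) = completionSet f ∧
      LinearMap.range f.toLinearMap ≤ Bf ∧
      ∀ y ∈ Bf, Coalgebra.comul (R := k) y ∈
        LinearMap.range (TensorProduct.map Bf.subtype Bf.subtype) := by
  have mem_iSup : ∀ y, y ∈ ⨆ n, LinearMap.ker (mkQIterComul f n) ↔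
      ∃ n, mkQIterComul f n y = 0 := fun y =>
    Submodule.mem_iSup_of_directed _ (monotone_ker_mkQIterComul f).directed_le
  refine ⟨⨆ n, LinearMap.ker (mkQIterComul f n), ?_, ?_, ?_⟩
  · ext y
    exact (mem_iSup y).trans (mem_completionSet_iff f).symm
  · rintro y hy
    exact (mem_iSup y).2 ⟨0, (Submodule.Quotient.mk_eq_zero _).2 hy⟩
  · intro y hy
    obtain ⟨n, hn⟩ := (mem_iSup y).1 hy
    obtain ⟨u, hu⟩ := comul_mem_range_map_ker_mkQIterComul f n hn
    have hle := le_iSup (fun n => LinearMap.ker (mkQIterComul f n)) n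
    refine ⟨TensorProduct.map (Submodule.inclusion hle) (Submodule.inclusion hle) u, ?_⟩
    rw [← hu, ← LinearMap.comp_apply, ← TensorProduct.map_comp]
    rfl
end

section
/- Let f : B_X → B_Y be an injective homomorphism of counital coalgebras over a field k and let B_f ⊆ B_Y be the completion of B_Y along f. Let h : B_X → D′ be an injective homomorphism of counital coalgebras such that every element of the quotient D′/h(B_X) is conilpotent with respect to the induced comultiplication, and let ψ : D′ → B_Y be a coalgebra homomorphism with ψ ∘ h = f. Then ψ(D′) ⊆ B_f. -/
open scoped TensorProduct

section
variable {k C D E : Type} [Field k]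
  [AddCommGroup C] [Module k C] [Coalgebra k C]
  [AddCommGroup D] [Module k D] [Coalgebra k D]
  [AddCommGroup E] [Module k E] [Coalgebra k E]

/-- The map `D ⧸ h(C) → E ⧸ f(C)` induced by a coalgebra homomorphism `ψ : D → E` under `C`. -/
noncomputable def quotMap (h : C →ₗc[k] D) (f : C →ₗc[k] E) (ψ : D →ₗc[k] E)
    (hψ : ψ.comp h = f) : CoalgQuot h →ₗ[k] CoalgQuot f :=
  Submodule.mapQ _ _ ψ.toLinearMap (by
    rintro _ ⟨c, rfl⟩
    exact ⟨c, (DFunLike.congr_fun hψ c).symm⟩)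

/-- A linear map between the quotients induces maps of the right-nested tensor powers. -/
noncomputable def quotTensorPowerMap {h : C →ₗc[k] D} {f : C →ₗc[k] E}
    (φ : CoalgQuot h →ₗ[k] CoalgQuot f) :
    (n : ℕ) → (quotTensorPower h n →ₗ[k] quotTensorPower f n)
  | 0 => φ
  | n + 1 => TensorProduct.map φ (quotTensorPowerMap φ n)

theorem quotComul_comp_quotMap (h : C →ₗc[k] D) (f : C →ₗc[k] E) (ψ : D →ₗc[k] E)
    (hψ : ψ.comp h = f) :
    quotComul f ∘ₗ quotMap h f ψ hψ =
      TensorProduct.map (quotMap h f ψ hψ) (quotMap h f ψ hψ) ∘ₗ quotComul h := by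
  refine Submodule.linearMap_qext _ (LinearMap.ext fun x => ?_)
  have hx : Coalgebra.comul (R := k) (ψ.toLinearMap x) =
      TensorProduct.map ψ.toLinearMap ψ.toLinearMap (Coalgebra.comul x) :=
    (CoalgHomClass.map_comp_comul_apply ψ x).symm
  have hmk : (LinearMap.range f.toLinearMap).mkQ ∘ₗ ψ.toLinearMap =
      quotMap h f ψ hψ ∘ₗ (LinearMap.range h.toLinearMap).mkQ := rfl
  change TensorProduct.map _ _ (Coalgebra.comul (R := k) (ψ.toLinearMap x)) =
    TensorProduct.map _ _ (TensorProduct.map _ _ (Coalgebra.comul (R := k) x))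
  rw [hx, TensorProduct.map_map, TensorProduct.map_map, hmk]

theorem quotComulFirst_comp_quotTensorPowerMap {h : C →ₗc[k] D} {f : C →ₗc[k] E}
    {φ : CoalgQuot h →ₗ[k] CoalgQuot f}
    (hφ : quotComul f ∘ₗ φ = TensorProduct.map φ φ ∘ₗ quotComul h) :
    ∀ n : ℕ, quotComulFirst f n ∘ₗ quotTensorPowerMap φ n =
      quotTensorPowerMap φ (n + 1) ∘ₗ quotComulFirst h n
  | 0 => hφ
  | n + 1 => by
    refine TensorProduct.ext' fun d t => ?_
    have hassoc := TensorProduct.map_map_comp_assoc_eq φ φ (quotTensorPowerMap φ n)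
    change TensorProduct.assoc k _ _ _ (quotComul f (φ d) ⊗ₜ quotTensorPowerMap φ n t) =
      TensorProduct.map φ (TensorProduct.map φ (quotTensorPowerMap φ n))
        (TensorProduct.assoc k _ _ _ (quotComul h d ⊗ₜ t))
    rw [← LinearMap.comp_apply (quotComul f) φ, hφ]
    exact (LinearMap.congr_fun hassoc (quotComul h d ⊗ₜ t)).symm

theorem quotIterComul_comp {h : C →ₗc[k] D} {f : C →ₗc[k] E}
    {φ : CoalgQuot h →ₗ[k] CoalgQuot f}
    (hφ : quotComul f ∘ₗ φ = TensorProduct.map φ φ ∘ₗ quotComul h) (n : ℕ) :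
    quotIterComul f n ∘ₗ φ = quotTensorPowerMap φ n ∘ₗ quotIterComul h n := by
  induction n with
  | zero => rfl
  | succ n ih =>
    change (quotComulFirst f n ∘ₗ quotIterComul f n) ∘ₗ φ =
      quotTensorPowerMap φ (n + 1) ∘ₗ (quotComulFirst h n ∘ₗ quotIterComul h n)
    rw [LinearMap.comp_assoc, ih, ← LinearMap.comp_assoc,
      quotComulFirst_comp_quotTensorPowerMap hφ, LinearMap.comp_assoc]

theorem QuotConilpotent.map {h : C →ₗc[k] D} {f : C →ₗc[k] E}
    {φ : CoalgQuot h →ₗ[k] CoalgQuot f}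
    (hφ : quotComul f ∘ₗ φ = TensorProduct.map φ φ ∘ₗ quotComul h) {d : CoalgQuot h}
    (hd : QuotConilpotent h d) : QuotConilpotent f (φ d) := by
  obtain ⟨n, hn, hd⟩ := hd
  refine ⟨n, hn, ?_⟩
  rw [← LinearMap.comp_apply, quotIterComul_comp hφ, LinearMap.comp_apply, hd, map_zero]

end

/-- **Universality of the completion**: let `f : B_X → B_Y` be an injective coalgebra
homomorphism with completion `B_f ⊆ B_Y`, let `h : B_X → D'` be an injective coalgebra
homomorphism such that every element of `D'/h(B_X)` is conilpotent, and let
`ψ : D' → B_Y` be a coalgebra homomorphism with `ψ ∘ h = f`.  Then `ψ(D') ⊆ B_f`. -/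
theorem completion_universal
    (k BX BY D' : Type) [Field k]
    [AddCommGroup BX] [Module k BX] [Coalgebra k BX]
    [AddCommGroup BY] [Module k BY] [Coalgebra k BY]
    [AddCommGroup D'] [Module k D'] [Coalgebra k D']
    (f : BX →ₗc[k] BY) (hf : Function.Injective f)
    (h : BX →ₗc[k] D') (hh : Function.Injective h)
    (hconil : ∀ d : CoalgQuot h, QuotConilpotent h d)
    (ψ : D' →ₗc[k] BY) (hψ : ψ.comp h = f) :
    ∀ x : D', ψ x ∈ completionSet f := by
  intro x
  exact (hconil ((LinearMap.range h.toLinearMap).mkQ x)).map (quotComul_comp_quotMap h f ψ hψ)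
end

section
/- Let f : B_X → B_Y be an injective homomorphism of counital coalgebras over a field k, and let B_f ⊆ B_Y be the completion of B_Y along f (a subcoalgebra of B_Y containing f(B_X)). Then: (i) the completion construction is idempotent — applying it to the corestricted injective coalgebra homomorphism B_X → B_f yields all of B_f, i.e. every element of the quotient B_f/f(B_X) is conilpotent with respect to its induced comultiplication; and (ii) if B_Y is smooth then B_f is smooth. -/
open scoped TensorProduct

/-- Contraction of the right tensor factor with a linear functional. -/
noncomputable def sliceRight {k P Q : Type} [Field k] [AddCommGroup P] [Module k P]
    [AddCommGroup Q] [Module k Q] (φ : Module.Dual k Q) : P ⊗[k] Q →ₗ[k] P :=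
  (TensorProduct.rid k P).toLinearMap ∘ₗ φ.lTensor P

section Slices
variable {k P P' Q Q' : Type} [Field k] [AddCommGroup P] [Module k P]
  [AddCommGroup P'] [Module k P'] [AddCommGroup Q] [Module k Q] [AddCommGroup Q'] [Module k Q']

@[simp]
theorem sliceRight_tmul (φ : Module.Dual k Q) (p : P) (q : Q) :
    sliceRight φ (p ⊗ₜ[k] q) = φ q • p := by
  simp [sliceRight]

theorem eq_zero_of_forall_sliceRight {t : P ⊗[k] Q}
    (h : ∀ φ : Module.Dual k Q, sliceRight φ t = 0) : t = 0 := by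
  classical
  let b := Module.Basis.ofVectorSpace k Q
  apply (TensorProduct.equivFinsuppOfBasisRight (M := P) b).injective
  ext i
  rw [TensorProduct.equivFinsuppOfBasisRight_apply, map_zero, Finsupp.zero_apply]
  exact h (b.coord i)

theorem sliceRight_map (S : P →ₗ[k] P') (T : Q →ₗ[k] Q') (φ : Module.Dual k Q')
    (t : P ⊗[k] Q) :
    sliceRight φ (TensorProduct.map S T t) = S (sliceRight (φ ∘ₗ T) t) := by
  induction t with
  | zero => simp
  | tmul p q => simp
  | add s t hs ht => simp only [map_add, hs, ht]

theorem sliceRight_mem_of_mem_range {K : Submodule k P} {L : Submodule k Q}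
    {S : P' →ₗ[k] P} {T : Q' →ₗ[k] Q} (hS : LinearMap.range S ≤ K)
    (hT : LinearMap.range T ≤ L) {χ : Module.Dual k Q} (hχ : ∀ x ∈ L, χ x = 0)
    {t : P ⊗[k] Q}
    (ht : t ∈ LinearMap.range (TensorProduct.map S (LinearMap.id : Q →ₗ[k] Q)) ⊔
      LinearMap.range (TensorProduct.map (LinearMap.id : P →ₗ[k] P) T)) :
    sliceRight χ t ∈ K := by
  obtain ⟨_, ⟨u, rfl⟩, _, ⟨v, rfl⟩, rfl⟩ := Submodule.mem_sup.1 ht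
  have h0 : χ ∘ₗ T = 0 := by
    ext x
    exact hχ _ (hT ⟨x, rfl⟩)
  rw [map_add, sliceRight_map, sliceRight_map, h0]
  have h1 : sliceRight (0 : Module.Dual k Q') v = (0 : P) := by simp [sliceRight]
  rw [h1, map_zero, add_zero]
  exact hS ⟨_, rfl⟩

/-- The operator `(id ⊗ φ) ∘ δ` attached to a functional `φ`. -/
noncomputable def rightAct (δ : Q →ₗ[k] Q ⊗[k] Q) (φ : Module.Dual k Q) : Q →ₗ[k] Q :=
  sliceRight φ ∘ₗ δ

/-- The increasing filtration starting at `U` whose next step consists of the elements mapped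
into the previous step by every `(id ⊗ φ) ∘ δ`. -/
noncomputable def conilFiltration (δ : Q →ₗ[k] Q ⊗[k] Q) (U : Submodule k Q) :
    ℕ → Submodule k Q
  | 0 => U
  | n + 1 => ⨅ φ : Module.Dual k Q, (conilFiltration δ U n).comap (rightAct δ φ)

theorem mem_conilFiltration_succ {δ : Q →ₗ[k] Q ⊗[k] Q} {U : Submodule k Q} {n : ℕ} {x : Q} :
    x ∈ conilFiltration δ U (n + 1) ↔
      ∀ φ : Module.Dual k Q, rightAct δ φ x ∈ conilFiltration δ U n := by
  simp [conilFiltration]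

theorem conilFiltration_conilFiltration (δ : Q →ₗ[k] Q ⊗[k] Q) (U : Submodule k Q) (m n : ℕ) :
    conilFiltration δ (conilFiltration δ U m) n = conilFiltration δ U (m + n) := by
  induction n with
  | zero => rfl
  | succ n ih =>
    ext x
    rw [← add_assoc, mem_conilFiltration_succ, mem_conilFiltration_succ, ih]

/-- Coassociativity, expressed through the operators `rightAct`. -/
def RightActMul (δ : Q →ₗ[k] Q ⊗[k] Q) : Prop :=
  ∀ (φ ψ : Module.Dual k Q) (x : Q),
    rightAct δ φ (rightAct δ ψ x) = rightAct δ (φ ∘ₗ rightAct δ ψ) x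

theorem mem_conilFiltration_of_annihilator {δ : Q →ₗ[k] Q ⊗[k] Q} (hδ : RightActMul δ)
    (U : Submodule k Q) (n : ℕ) (x : Q)
    (h : ∀ χ : Module.Dual k Q, (∀ v ∈ conilFiltration δ ⊥ n, χ v = 0) → rightAct δ χ x ∈ U) :
    x ∈ conilFiltration δ U (n + 1) := by
  induction n generalizing x with
  | zero =>
    refine mem_conilFiltration_succ.2 fun φ => h φ fun v hv => ?_
    rw [(Submodule.mem_bot k).1 hv, map_zero]
  | succ n ih =>
    refine mem_conilFiltration_succ.2 fun φ => ih _ fun χ hχ => ?_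
    rw [hδ]
    exact h _ fun v hv => hχ _ (mem_conilFiltration_succ.1 hv φ)

theorem mem_conilFiltration_of_map_mem {δ : Q →ₗ[k] Q ⊗[k] Q} {δ' : Q' →ₗ[k] Q' ⊗[k] Q'}
    {i : Q' →ₗ[k] Q} (hi : Function.Injective i)
    (hδ : ∀ x, δ (i x) = TensorProduct.map i i (δ' x)) (n : ℕ) (x : Q')
    (hx : i x ∈ conilFiltration δ ⊥ n) : x ∈ conilFiltration δ' ⊥ n := by
  induction n generalizing x with
  | zero =>
    exact (Submodule.mem_bot k).2 (hi (((Submodule.mem_bot k).1 hx).trans (map_zero i).symm))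
  | succ n ih =>
    obtain ⟨r, hr⟩ := i.exists_leftInverse_of_injective (LinearMap.ker_eq_bot.2 hi)
    refine mem_conilFiltration_succ.2 fun φ => ih _ ?_
    have h := mem_conilFiltration_succ.1 hx (φ ∘ₗ r)
    rwa [rightAct, LinearMap.comp_apply, hδ, sliceRight_map, LinearMap.comp_assoc, hr,
      LinearMap.comp_id] at h

end Slices

theorem rightActMul_comul {k B : Type} [Field k] [AddCommGroup B] [Module k B] [Coalgebra k B] :
    RightActMul (Coalgebra.comul (R := k) (A := B)) := by
  intro φ ψ x
  have hl : ∀ t : B ⊗[k] B,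
      sliceRight φ (Coalgebra.comul (R := k) (sliceRight ψ t)) =
      sliceRight φ ((sliceRight ψ).lTensor B
        (TensorProduct.assoc k B B B (Coalgebra.comul.rTensor B t))) := by
    intro t
    induction t with
    | zero => simp
    | add s t hs ht => simp only [map_add, hs, ht]
    | tmul p q =>
      rw [LinearMap.rTensor_tmul, sliceRight_tmul, map_smul, map_smul]
      generalize Coalgebra.comul (R := k) p = u
      induction u with
      | zero => simp
      | add s t hs ht => simp only [map_add, TensorProduct.add_tmul, smul_add, hs, ht]
      | tmul a b => simp [smul_smul]
  change sliceRight φ (Coalgebra.comul (R := k) (sliceRight ψ (Coalgebra.comul x))) = _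
  rw [hl, Coalgebra.coassoc_apply, ← LinearMap.comp_apply, ← LinearMap.comp_apply,
    LinearMap.comp_assoc, ← LinearMap.lTensor_comp, LinearMap.comp_apply, LinearMap.lTensor,
    sliceRight_map]
  rfl

section Quotient
variable {k C D : Type} [Field k]
  [AddCommGroup C] [Module k C] [Coalgebra k C]
  [AddCommGroup D] [Module k D] [Coalgebra k D]

theorem quotComul_mkQ (f : C →ₗc[k] D) (b : D) :
    quotComul f ((LinearMap.range f.toLinearMap).mkQ b) =
      TensorProduct.map (LinearMap.range f.toLinearMap).mkQ (LinearMap.range f.toLinearMap).mkQ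
        (Coalgebra.comul (R := k) b) := rfl

theorem rightAct_quotComul_mkQ (f : C →ₗc[k] D) (φ : Module.Dual k (CoalgQuot f)) (b : D) :
    rightAct (quotComul f) φ ((LinearMap.range f.toLinearMap).mkQ b) =
      (LinearMap.range f.toLinearMap).mkQ
        (rightAct Coalgebra.comul (φ ∘ₗ (LinearMap.range f.toLinearMap).mkQ) b) := by
  rw [rightAct, LinearMap.comp_apply, quotComul_mkQ, sliceRight_map]
  rfl

theorem rightActMul_quotComul (f : C →ₗc[k] D) : RightActMul (quotComul f) := by
  intro φ ψ d
  obtain ⟨b, rfl⟩ := Submodule.mkQ_surjective _ d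
  rw [rightAct_quotComul_mkQ, rightAct_quotComul_mkQ, rightActMul_comul, rightAct_quotComul_mkQ]
  congr 3
  ext y
  simp only [LinearMap.comp_apply, rightAct_quotComul_mkQ]

/-- The reassociation isomorphism appending a factor at the end of a right-nested tensor power. -/
noncomputable def quotTensorPowerAppend (f : C →ₗc[k] D) :
    (n : ℕ) → (quotTensorPower f n ⊗[k] CoalgQuot f ≃ₗ[k] quotTensorPower f (n + 1))
  | 0 => LinearEquiv.refl k (CoalgQuot f ⊗[k] CoalgQuot f)
  | n + 1 =>
      (TensorProduct.assoc k (CoalgQuot f) (quotTensorPower f n) (CoalgQuot f)).trans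
        ((quotTensorPowerAppend f n).lTensor (CoalgQuot f))

theorem quotComulFirst_append (f : C →ₗc[k] D) (n : ℕ)
    (t : quotTensorPower f n ⊗[k] CoalgQuot f) :
    quotComulFirst f (n + 1) (quotTensorPowerAppend f n t) =
      quotTensorPowerAppend f (n + 1) ((quotComulFirst f n).rTensor (CoalgQuot f) t) := by
  cases n with
  | zero =>
    change TensorProduct.assoc k _ _ _ (TensorProduct.map (quotComul f) LinearMap.id t) =
      (LinearEquiv.refl k (CoalgQuot f ⊗[k] CoalgQuot f)).lTensor (CoalgQuot f)
        (TensorProduct.assoc k (CoalgQuot f) (CoalgQuot f) (CoalgQuot f)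
          ((quotComul f).rTensor (CoalgQuot f) t))
    simp [LinearMap.rTensor]
  | succ n =>
    change (CoalgQuot f ⊗[k] quotTensorPower f n) ⊗[k] CoalgQuot f at t
    change TensorProduct.assoc k (CoalgQuot f) (CoalgQuot f) (quotTensorPower f (n + 1))
        (TensorProduct.map (quotComul f) LinearMap.id
          ((quotTensorPowerAppend f n).lTensor (CoalgQuot f)
            (TensorProduct.assoc k (CoalgQuot f) (quotTensorPower f n) (CoalgQuot f) t))) =
      ((TensorProduct.assoc k (CoalgQuot f) (quotTensorPower f n) (CoalgQuot f)).trans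
          ((quotTensorPowerAppend f n).lTensor (CoalgQuot f))).lTensor (CoalgQuot f)
        (TensorProduct.assoc k (CoalgQuot f) (CoalgQuot f ⊗[k] quotTensorPower f n) (CoalgQuot f)
          (((TensorProduct.assoc k (CoalgQuot f) (CoalgQuot f) (quotTensorPower f n)).toLinearMap
            ∘ₗ (TensorProduct.map (quotComul f) LinearMap.id)).rTensor (CoalgQuot f) t))
    induction t with
    | zero => simp
    | add s t hs ht => simp only [map_add, hs, ht]
    | tmul u q =>
      induction u with
      | zero => simp
      | add s t hs ht => simp only [map_add, TensorProduct.add_tmul, hs, ht]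
      | tmul d p =>
        simp only [LinearMap.rTensor_tmul, LinearMap.comp_apply, TensorProduct.map_tmul,
          TensorProduct.assoc_tmul, LinearEquiv.lTensor_tmul, LinearMap.id_apply,
          LinearEquiv.coe_coe]
        generalize quotComul f d = w
        induction w with
        | zero => simp
        | add s t hs ht => simp only [map_add, TensorProduct.add_tmul, hs, ht]
        | tmul a b => simp

theorem quotIterComul_succ (f : C →ₗc[k] D) (n : ℕ) (d : CoalgQuot f) :
    quotIterComul f (n + 1) d =
      quotTensorPowerAppend f n ((quotIterComul f n).rTensor (CoalgQuot f) (quotComul f d)) := by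
  induction n with
  | zero =>
    change quotComul f d = (LinearMap.id (R := k) (M := CoalgQuot f)).rTensor (CoalgQuot f)
      (quotComul f d)
    simp
  | succ n ih =>
    rw [quotIterComul, LinearMap.comp_apply, ih, quotComulFirst_append, quotIterComul,
      LinearMap.rTensor_comp, LinearMap.comp_apply]

theorem quotIterComul_eq_zero_iff (f : C →ₗc[k] D) (n : ℕ) (d : CoalgQuot f) :
    quotIterComul f n d = 0 ↔ d ∈ conilFiltration (quotComul f) ⊥ n := by
  induction n generalizing d with
  | zero => exact (Submodule.mem_bot k).symm
  | succ n ih =>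
    have key : ∀ φ : Module.Dual k (CoalgQuot f),
        sliceRight φ ((quotIterComul f n).rTensor (CoalgQuot f) (quotComul f d)) =
          quotIterComul f n (rightAct (quotComul f) φ d) := fun φ => by
      rw [LinearMap.rTensor, sliceRight_map]
      rfl
    rw [quotIterComul_succ, LinearEquiv.map_eq_zero_iff, mem_conilFiltration_succ]
    refine ⟨fun h φ => ?_, fun h => eq_zero_of_forall_sliceRight fun φ => ?_⟩
    · rw [← ih, ← key, h, map_zero]
    · rw [key, ih]
      exact h φ

theorem conilFiltration_quotComul_mono (f : C →ₗc[k] D) :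
    Monotone (conilFiltration (quotComul f) ⊥) := by
  refine monotone_nat_of_le_succ fun n d hd => ?_
  rw [← quotIterComul_eq_zero_iff] at hd ⊢
  rw [quotIterComul, LinearMap.comp_apply, hd, map_zero]

theorem quotConilpotent_iff (f : C →ₗc[k] D) (d : CoalgQuot f) :
    QuotConilpotent f d ↔ ∃ n, d ∈ conilFiltration (quotComul f) ⊥ n := by
  constructor
  · rintro ⟨n, -, h⟩
    exact ⟨n, (quotIterComul_eq_zero_iff f n d).1 h⟩
  · rintro ⟨n, h⟩
    exact ⟨n + 1, by lia, (quotIterComul_eq_zero_iff f _ d).2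
      (conilFiltration_quotComul_mono f n.le_succ h)⟩

theorem exists_range_le_conilFiltration (f : C →ₗc[k] D) {V : Type} [AddCommGroup V]
    [Module k V] [FiniteDimensional k V] (T : V →ₗ[k] CoalgQuot f)
    (hT : ∀ v, QuotConilpotent f (T v)) :
    ∃ n, LinearMap.range T ≤ conilFiltration (quotComul f) ⊥ n := by
  let b := Module.finBasis k V
  choose n hn using fun i => (quotConilpotent_iff f _).1 (hT (b i))
  refine ⟨Finset.univ.sup n, ?_⟩
  rw [LinearMap.range_le_iff_comap, eq_top_iff, ← b.span_eq, Submodule.span_le]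
  rintro _ ⟨i, rfl⟩
  exact conilFiltration_quotComul_mono f (Finset.le_sup (Finset.mem_univ i)) (hn i)

/-- A coalgebra homomorphism that sends the source of a minimal conilpotent extension into the
completion sends the whole extension into the completion. -/
theorem IsMinimalConilpotentExtension.mem_completionSet (f : C →ₗc[k] D) {A B : Type}
    [AddCommGroup A] [Module k A] [Coalgebra k A] [FiniteDimensional k A]
    [AddCommGroup B] [Module k B] [Coalgebra k B] {ι : A →ₗc[k] B}
    (hι : IsMinimalConilpotentExtension ι) (h : B →ₗc[k] D)
    (hA : ∀ a, h (ι a) ∈ completionSet f) (b : B) : h b ∈ completionSet f := by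
  set q := (LinearMap.range f.toLinearMap).mkQ ∘ₗ h.toLinearMap with hq
  obtain ⟨N, hN⟩ := exists_range_le_conilFiltration f (q ∘ₗ ι.toLinearMap) hA
  refine (quotConilpotent_iff f _).2 ⟨N + (N + 1), ?_⟩
  rw [← conilFiltration_conilFiltration]
  refine mem_conilFiltration_of_annihilator (rightActMul_quotComul f) _ _ _ fun χ hχ => ?_
  refine sliceRight_mem_of_mem_range hN hN hχ ?_
  have hδ : quotComul f ((LinearMap.range f.toLinearMap).mkQ (h b)) =
      TensorProduct.map q q (Coalgebra.comul (R := k) b) := by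
    rw [quotComul_mkQ, ← CoalgHomClass.map_comp_comul_apply, hq, TensorProduct.map_comp]
    rfl
  rw [hδ]
  obtain ⟨_, ⟨u, rfl⟩, _, ⟨v, rfl⟩, huv⟩ := Submodule.mem_sup.1 (hι.2 b)
  rw [← huv, map_add]
  refine Submodule.add_mem_sup ⟨TensorProduct.map LinearMap.id q u, ?_⟩
    ⟨TensorProduct.map q LinearMap.id v, ?_⟩
  · simp only [← LinearMap.comp_apply, ← TensorProduct.map_comp, LinearMap.comp_id,
      LinearMap.id_comp]
  · simp only [← LinearMap.comp_apply, ← TensorProduct.map_comp, LinearMap.comp_id,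
      LinearMap.id_comp]

theorem IsConilpotentChain.mem_completionSet (f : C →ₗc[k] D) (n : ℕ) {A B : Type}
    [AddCommGroup A] [Module k A] [Coalgebra k A] [FiniteDimensional k A]
    [AddCommGroup B] [Module k B] [Coalgebra k B] [FiniteDimensional k B] {ι : A →ₗc[k] B}
    (hι : IsConilpotentChain k n A B ι) (h : B →ₗc[k] D)
    (hA : ∀ a, h (ι a) ∈ completionSet f) (b : B) : h b ∈ completionSet f := by
  induction n generalizing B with
  | zero => exact IsMinimalConilpotentExtension.mem_completionSet f hι h hA b
  | succ n ih =>
    obtain ⟨E, g, i, hg, hi, rfl⟩ := hι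
    have : FiniteDimensional k E.carrier :=
      FiniteDimensional.of_injective i.toLinearMap hi.1
    exact IsMinimalConilpotentExtension.mem_completionSet f hi h (ih hg (h.comp i) hA) b

end Quotient

/-- A coalgebra homomorphism factors through an injective one whose image contains its image. -/
theorem CoalgHom.exists_comp_eq_of_range_le {k A B E : Type} [Field k]
    [AddCommGroup A] [Module k A] [Coalgebra k A] [AddCommGroup B] [Module k B] [Coalgebra k B]
    [AddCommGroup E] [Module k E] [Coalgebra k E] (j : E →ₗc[k] B) (hj : Function.Injective j)
    (h : A →ₗc[k] B) (hh : LinearMap.range h.toLinearMap ≤ LinearMap.range j.toLinearMap) :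
    ∃ l : A →ₗc[k] E, j.comp l = h := by
  let e := LinearEquiv.ofInjective j.toLinearMap hj
  let l : A →ₗ[k] E := e.symm.toLinearMap ∘ₗ
    h.toLinearMap.codRestrict (LinearMap.range j.toLinearMap) fun a => hh ⟨a, rfl⟩
  have hl : j.toLinearMap ∘ₗ l = h.toLinearMap := by
    ext a
    exact congrArg Subtype.val (e.apply_symm_apply _)
  refine ⟨{ l with counit_comp := ?_, map_comp_comul := ?_ }, ?_⟩
  · rw [← j.counit_comp, LinearMap.comp_assoc, hl, h.counit_comp]
  · change TensorProduct.map l l ∘ₗ _ = _ ∘ₗ l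
    rw [← LinearMap.cancel_left
      (TensorProduct.map_injective_of_flat_flat j.toLinearMap j.toLinearMap hj hj),
      ← LinearMap.comp_assoc, ← TensorProduct.map_comp, hl, ← LinearMap.comp_assoc,
      j.map_comp_comul, LinearMap.comp_assoc, hl, h.map_comp_comul]
  · ext a
    exact LinearMap.congr_fun hl a

/-- **Idempotency and smoothness of the completion.**  Let `f : B_X → B_Y` be an
injective coalgebra homomorphism, and let `Bf ⊆ B_Y` be the completion of `B_Y` along
`f` — a subcoalgebra of `B_Y` containing `f(B_X)`.  Realize `Bf` as a counital coalgebra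
`E` via an injective coalgebra homomorphism `j : E → B_Y` with image `Bf` and a
corestriction `f' : B_X → E` of `f` (such a realization always exists, and the coalgebra
structure on it is unique since `j` is injective).  Then: (i) the completion
construction is idempotent — every element of the quotient `E/f'(B_X)` is conilpotent
with respect to its induced comultiplication; and (ii) if `B_Y` is smooth, then the
completion `E` is smooth. -/
theorem completion_idempotent_and_smooth
    (k BX BY : Type) [Field k]
    [AddCommGroup BX] [Module k BX] [Coalgebra k BX]
    [AddCommGroup BY] [Module k BY] [Coalgebra k BY]
    (f : BX →ₗc[k] BY) (hf : Function.Injective f)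
    (Bf : Submodule k BY)
    (hBf : (Bf : Set BY) = completionSet f)
    (hBf_range : LinearMap.range f.toLinearMap ≤ Bf)
    (hBf_sub : ∀ y ∈ Bf, Coalgebra.comul (R := k) y ∈
      LinearMap.range (TensorProduct.map Bf.subtype Bf.subtype))
    (E : Type) [AddCommGroup E] [Module k E] [Coalgebra k E]
    (j : E →ₗc[k] BY) (hj : Function.Injective j)
    (hj_range : LinearMap.range j.toLinearMap = Bf)
    (f' : BX →ₗc[k] E) (hf' : j.comp f' = f) :
    (∀ d : CoalgQuot f', QuotConilpotent f' d) ∧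
    (IsSmoothCoalgebra k BY → IsSmoothCoalgebra k E) := by
  have hEmem : ∀ y : BY, y ∈ LinearMap.range j.toLinearMap ↔ y ∈ completionSet f := fun y => by
    rw [hj_range, ← hBf]
    rfl
  refine ⟨fun d => ?_, fun hsm C₁ C₂ _ _ _ _ _ _ hC₁ hC₂ ι hι g => ?_⟩
  · obtain ⟨e, rfl⟩ := Submodule.mkQ_surjective _ d
    have hrange : (LinearMap.range f.toLinearMap).comap j.toLinearMap =
        LinearMap.range f'.toLinearMap := by
      subst hf'
      ext x
      constructor
      · rintro ⟨b, hb⟩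
        exact ⟨b, hj hb⟩
      · rintro ⟨b, rfl⟩
        exact ⟨b, rfl⟩
    let i : CoalgQuot f' →ₗ[k] CoalgQuot f := Submodule.mapQ _ _ j.toLinearMap hrange.ge
    have hi : Function.Injective i := by
      rw [← LinearMap.ker_eq_bot, Submodule.ker_mapQ, hrange, Submodule.mkQ_map_self]
    have hcomul : ∀ x, quotComul f (i x) = TensorProduct.map i i (quotComul f' x) := by
      intro x
      obtain ⟨y, rfl⟩ := Submodule.mkQ_surjective _ x
      change quotComul f ((LinearMap.range f.toLinearMap).mkQ (j y)) = _
      rw [quotComul_mkQ, quotComul_mkQ, ← CoalgHomClass.map_comp_comul_apply]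
      generalize Coalgebra.comul (R := k) y = t
      change _ = TensorProduct.map i i (TensorProduct.map _ _ t)
      rw [← LinearMap.comp_apply, ← LinearMap.comp_apply (TensorProduct.map i i),
        ← TensorProduct.map_comp, ← TensorProduct.map_comp]
      rfl
    obtain ⟨n, hn⟩ := (quotConilpotent_iff f _).1 ((hEmem (j e)).1 ⟨e, rfl⟩)
    exact (quotConilpotent_iff f' _).2 ⟨n, mem_conilFiltration_of_map_mem hi hcomul n _ hn⟩
  · obtain ⟨h, hh⟩ := hsm C₁ C₂ hC₁ hC₂ ι hι (j.comp g)
    obtain ⟨n, hn⟩ := hι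
    have hmem := IsConilpotentChain.mem_completionSet f n hn h fun a =>
      (hEmem _).1 ⟨g a, (DFunLike.congr_fun hh a).symm⟩
    obtain ⟨l, hl⟩ := CoalgHom.exists_comp_eq_of_range_le j hj h <| by
      rintro _ ⟨c, rfl⟩
      exact (hEmem _).2 (hmem c)
    refine ⟨l, CoalgHom.ext fun c => hj ?_⟩
    have := DFunLike.congr_fun hh c
    rwa [← hl] at this
end
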